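/- Let n > 1 and m ≥ 1 be integers. The set {(a_1, …, a_m) ∈ T_n^m : there exist b_1, …, b_m ∈ T_n with b_1 a_1 + ⋯ + b_m a_m = 1} is dense in T_n^m (with the product of the operator-norm topologies) if and only if m ≥ ⌊n/2⌋ + 1; that is, the topological (Bass) stable rank of the Toeplitz algebra T_n = T^{⊗n} equals ⌊n/2⌋ + 1. -/

import Mathlib

noncomputable section

/-- `H n` is the Hilbert space `ℓ²(ℕ^n)`. -/
abbrev Hn (n : ℕ) : Type := lp (fun _ : (Fin n → ℕ) => ℂ) 2

/-- the standard basis vector `δ_z`. -/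
def delta {n : ℕ} (z : Fin n → ℕ) : Hn n := lp.single 2 z 1

/-- `T` is the `i`-th coordinate shift: `T δ_z = δ_{z + e_i}`. -/
def IsShift {n : ℕ} (i : Fin n) (T : Hn n →L[ℂ] Hn n) : Prop :=
  ∀ z : Fin n → ℕ, T (delta z) = delta (Function.update z i (z i + 1))

/-- The Toeplitz algebra `T_n`: the smallest norm-closed star-subalgebra of `B(H_n)`
containing the coordinate shifts. -/
def Toeplitz (n : ℕ) : StarSubalgebra ℂ (Hn n →L[ℂ] Hn n) :=
  (StarAlgebra.adjoin ℂ {T : Hn n →L[ℂ] Hn n | ∃ i : Fin n, IsShift i T}).topologicalClosure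

section Brouwer

open MeasureTheory Metric

/-- Lagrange interpolation as a quadrature rule -/
lemma exists_extrapolation_weights (D : ℕ) {t₀ : ℝ} (ht₀ : 0 < t₀) :
    ∃ v w : Fin (D + 1) → ℝ, (∀ j, 0 < v j ∧ v j < t₀) ∧
      ∀ P : Polynomial ℝ, P.natDegree ≤ D → P.eval 1 = ∑ j, w j * P.eval (v j) := by
  refine ⟨fun j => t₀ * ((j + 1 : ℝ) / (D + 2)), fun j => (Lagrange.basis Finset.univ
    (fun j : Fin (D + 1) => t₀ * ((j + 1 : ℝ) / (D + 2))) j).eval 1, fun j => ⟨by positivity, ?_⟩, ?_⟩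
  · have hj : (j : ℝ) + 1 < D + 2 := by
      have := j.2
      have : (j : ℝ) < (D + 1 : ℕ) := by exact_mod_cast this
      push_cast at this; linarith
    have : ((j : ℝ) + 1) / (D + 2) < 1 := by rw [div_lt_one (by positivity)]; exact hj
    nlinarith
  · intro P hP
    have hinj : Set.InjOn (fun j : Fin (D + 1) => t₀ * ((j + 1 : ℝ) / (D + 2)))
        (Finset.univ : Finset (Fin (D + 1))) := by
      intro i _ j _ hij
      have h1 : ((i : ℝ) + 1) / (D + 2) = ((j : ℝ) + 1) / (D + 2) := mul_left_cancel₀ ht₀.ne' hij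
      rw [div_left_inj' (by positivity)] at h1
      have h2 : (i : ℝ) = j := by linarith
      exact Fin.ext (by exact_mod_cast h2)
    have hdeg : P.degree < (Finset.univ : Finset (Fin (D + 1))).card := by
      rw [Finset.card_univ, Fintype.card_fin]
      refine P.degree_le_natDegree.trans_lt ?_
      exact_mod_cast Nat.lt_succ_of_le hP
    conv_lhs => rw [Lagrange.eq_interpolate hinj hdeg]
    rw [Lagrange.interpolate_apply, Polynomial.eval_finsetSum]
    refine Finset.sum_congr rfl fun j _ => ?_
    rw [Polynomial.eval_mul, Polynomial.eval_C, mul_comm]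

lemma exists_polynomial_det {ι : Type*} [Fintype ι] [DecidableEq ι]
    (A : (ι → ℝ) →L[ℝ] (ι → ℝ)) :
    ∃ P : Polynomial ℝ, P.natDegree ≤ Fintype.card ι ∧
      ∀ t : ℝ, P.eval t = (ContinuousLinearMap.id ℝ (ι → ℝ) + t • A).det := by
  refine ⟨_, Polynomial.natDegree_det_X_add_C_le
    (LinearMap.toMatrix' (A : (ι → ℝ) →ₗ[ℝ] (ι → ℝ))) 1, fun t => ?_⟩
  rw [← Polynomial.coe_evalRingHom, RingHom.map_det, ContinuousLinearMap.det,
    ← LinearMap.det_toMatrix']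
  congr 1
  ext i j
  simp [Matrix.one_apply, LinearMap.toMatrix'_apply, Pi.single_apply]
  by_cases hij : i = j <;> simp [hij] <;> ring

lemma exists_polynomial_kernel {ι : Type*} [Fintype ι] (x h : ι → ℝ) (C : ℝ) (k : ℕ) :
    ∃ P : Polynomial ℝ, P.natDegree ≤ 2 * k ∧
      ∀ t : ℝ, P.eval t = (C - ∑ i, (x i + t * h i) ^ 2) ^ k := by
  refine ⟨(Polynomial.C C - ∑ i, (Polynomial.C (x i) + Polynomial.X * Polynomial.C (h i)) ^ 2) ^ k,
    ?_, fun t => by simp [Polynomial.eval_finsetSum, mul_comm t]⟩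
  rw [mul_comm]
  refine Polynomial.natDegree_pow_le_of_le k ?_
  refine (Polynomial.natDegree_sub_le_of_le (m := 2) (n := 2) (by simp) ?_).trans (by simp)
  refine Polynomial.natDegree_sum_le_of_forall_le _ _ fun i _ => ?_
  compute_degree

variable {ι : Type*} [Fintype ι]

/-- For small `t` the perturbation `id + t h` preserves the ball and the integral. -/
lemma integral_comp_perturbation {h : (ι → ℝ) → (ι → ℝ)} (hh : ContDiff ℝ 1 h) {R : ℝ}
    (hR : ∀ x, R ≤ ‖x‖ → h x = 0) :
    ∃ t₀ : ℝ, 0 < t₀ ∧ ∀ t : ℝ, 0 < t → t < t₀ → ∀ g : (ι → ℝ) → ℝ,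
      ∫ x in closedBall 0 R, (ContinuousLinearMap.id ℝ (ι → ℝ) + t • fderiv ℝ h x).det *
        g (x + t • h x) = ∫ x in closedBall 0 R, g x := by
  have hsupp : HasCompactSupport h := by
    refine HasCompactSupport.intro (isCompact_closedBall (0 : ι → ℝ) R) fun x hx => hR x ?_
    simp at hx; exact hx.le
  obtain ⟨K, hK⟩ := hh.lipschitzWith_of_hasCompactSupport hsupp one_ne_zero
  have hdet : ∀ᶠ A : (ι → ℝ) →L[ℝ] (ι → ℝ) in nhds 0,
      0 < (ContinuousLinearMap.id ℝ (ι → ℝ) + A).det := by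
    have hc : Continuous fun A : (ι → ℝ) →L[ℝ] (ι → ℝ) =>
      (ContinuousLinearMap.id ℝ (ι → ℝ) + A).det :=
      ContinuousLinearMap.continuous_det.comp (continuous_const.add continuous_id)
    refine hc.continuousAt.eventually (lt_mem_nhds ?_)
    simp [ContinuousLinearMap.det]
  obtain ⟨δ, hδ, hδdet⟩ := Metric.eventually_nhds_iff.1 hdet
  refine ⟨min (δ / (K + 1)) (1 / (K + 1)), by positivity, fun t ht htt g => ?_⟩
  have ht1 : t * (K + 1) < δ := by
    rw [← lt_div_iff₀ (by positivity)]; exact htt.trans_le (min_le_left _ _)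
  have ht2 : t * (K + 1) < 1 := by
    rw [← lt_div_iff₀ (by positivity)]; exact htt.trans_le (min_le_right _ _)
  have hlip : ∀ x y, ‖t • h x - t • h y‖ ≤ t * K * ‖x - y‖ := by
    intro x y
    rw [← smul_sub, norm_smul, Real.norm_of_nonneg ht.le, mul_assoc]
    exact mul_le_mul_of_nonneg_left (by simpa [dist_eq_norm] using hK.dist_le_mul x y) ht.le
  have hinj : Function.Injective fun x => x + t • h x := by
    intro x y hxy
    have h1 : x - y = -(t • h x - t • h y) := by
      have : x + t • h x = y + t • h y := hxy
      linear_combination (exp := 1) this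
    have h2 := hlip x y
    have h3 : ‖x - y‖ = ‖t • h x - t • h y‖ := by rw [h1, norm_neg]
    have h4 : ‖x - y‖ = 0 := by
      nlinarith [norm_nonneg (x - y), K.2]
    exact sub_eq_zero.1 (norm_eq_zero.1 h4)
  have hsurj : ∀ y, ∃ x, x + t • h x = y := by
    intro y
    have hc : ContractingWith (t.toNNReal * K) fun x => y - t • h x := by
      refine ⟨?_, LipschitzWith.of_dist_le_mul fun a b => ?_⟩
      · rw [← NNReal.coe_lt_coe]; push_cast
        rw [Real.coe_toNNReal _ ht.le]
        nlinarith
      · rw [dist_eq_norm, dist_eq_norm]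
        have := hlip b a
        rw [norm_sub_rev b a] at this
        simpa [Real.coe_toNNReal _ ht.le] using this
    exact ⟨_, by have := hc.fixedPoint_isFixedPt; unfold Function.IsFixedPt at this
                 exact (eq_sub_iff_add_eq.1 this.symm)⟩
  have himage : (fun x => x + t • h x) '' closedBall 0 R = closedBall 0 R := by
    ext y
    constructor
    · rintro ⟨x, hx, rfl⟩
      by_contra hy
      have hy' : R < ‖x + t • h x‖ := by simpa using hy
      have : x + t • h x = x := hinj (by simp [hR _ hy'.le])
      rw [this] at hy'
      simp at hx; linarith
    · intro hy
      obtain ⟨x, hx⟩ := hsurj y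
      refine ⟨x, ?_, hx⟩
      by_contra hxR
      have hx' : R < ‖x‖ := by simpa using hxR
      rw [hR x hx'.le] at hx
      simp at hx hy; rw [hx] at hx'; linarith
  have hder : ∀ x ∈ closedBall (0 : ι → ℝ) R, HasFDerivWithinAt (fun x => x + t • h x)
      (ContinuousLinearMap.id ℝ (ι → ℝ) + t • fderiv ℝ h x) (closedBall 0 R) x := fun x _ =>
    ((hasFDerivAt_id x).add (((hh.differentiable one_ne_zero) x).hasFDerivAt.const_smul t)).hasFDerivWithinAt
  have := integral_image_eq_integral_abs_det_fderiv_smul volume measurableSet_closedBall hder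
    hinj.injOn g
  rw [himage] at this
  rw [this]
  refine integral_congr_ae (Filter.Eventually.of_forall fun x => ?_)
  have hpos : 0 < (ContinuousLinearMap.id ℝ (ι → ℝ) + t • fderiv ℝ h x).det := by
    refine hδdet ?_
    rw [dist_zero_right, norm_smul, Real.norm_of_nonneg ht.le]
    have : ‖fderiv ℝ h x‖ ≤ K := norm_fderiv_le_of_lipschitz ℝ hK
    nlinarith [norm_nonneg (fderiv ℝ h x)]
  simp only [smul_eq_mul, abs_of_pos hpos]

/-- Integral formula for the degree-one map. -/
lemma integral_kernel_comp {h : (ι → ℝ) → (ι → ℝ)} (hh : ContDiff ℝ 1 h) {R : ℝ}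
    (hR : ∀ x, R ≤ ‖x‖ → h x = 0) (C : ℝ) (k : ℕ) :
    ∫ x in closedBall 0 R, (ContinuousLinearMap.id ℝ (ι → ℝ) + fderiv ℝ h x).det *
        (C - ∑ i, (x i + h x i) ^ 2) ^ k =
      ∫ x in closedBall (0 : ι → ℝ) R, (C - ∑ i, x i ^ 2) ^ k := by
  classical
  obtain ⟨t₀, ht₀, H⟩ := integral_comp_perturbation hh hR
  obtain ⟨v, w, hv, hw⟩ := exists_extrapolation_weights (Fintype.card ι + 2 * k) ht₀
  set F : ℝ → (ι → ℝ) → ℝ := fun t x => (ContinuousLinearMap.id ℝ (ι → ℝ) + t • fderiv ℝ h x).det *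
    (C - ∑ i, (x i + t * h x i) ^ 2) ^ k with hF
  have hsum : ∀ x, F 1 x = ∑ j, w j * F (v j) x := by
    intro x
    obtain ⟨P, hP, hPe⟩ := exists_polynomial_det (fderiv ℝ h x)
    obtain ⟨Q, hQ, hQe⟩ := exists_polynomial_kernel x (h x) C k
    have := hw (P * Q) (Polynomial.natDegree_mul_le_of_le hP hQ)
    simpa only [Polynomial.eval_mul, hPe, hQe] using this
  have hcont : ∀ t, Continuous (F t) := by
    intro t
    refine (ContinuousLinearMap.continuous_det.comp (continuous_const.add
      ((hh.continuous_fderiv one_ne_zero).const_smul t))).mul ?_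
    have := hh.continuous
    fun_prop
  have hF_integrable : ∀ t, IntegrableOn (F t) (closedBall 0 R) := fun t =>
    (hcont t).continuousOn.integrableOn_compact (isCompact_closedBall _ _)
  have hconst : ∀ j, ∫ x in closedBall 0 R, F (v j) x =
      ∫ x in closedBall (0 : ι → ℝ) R, (C - ∑ i, x i ^ 2) ^ k := fun j => by
    simpa [hF] using H (v j) (hv j).1 (hv j).2 fun x => (C - ∑ i, x i ^ 2) ^ k
  have hw1 : ∑ j, w j = 1 := by simpa using (hw 1 (by simp)).symm
  have : ∫ x in closedBall 0 R, F 1 x =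
      ∫ x in closedBall (0 : ι → ℝ) R, (C - ∑ i, x i ^ 2) ^ k := by
    simp_rw [hsum]
    rw [integral_finsetSum _ fun j _ => (hF_integrable (v j)).const_mul _]
    simp_rw [integral_const_mul, hconst, ← Finset.sum_mul, hw1, one_mul]
  simpa [hF] using this

/-- A form of Brouwer's theorem. -/
theorem exists_zero_of_eq_id_outside_ball {f : (ι → ℝ) → (ι → ℝ)} (hf : ContDiff ℝ 1 f) {R : ℝ}
    (hR0 : 0 < R) (hR : ∀ x, R ≤ ‖x‖ → f x = x) : ∃ x, f x = 0 := by
  classical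
  by_contra! hne
  have hh : ContDiff ℝ 1 fun x => f x - x := hf.sub contDiff_id
  have hfsq : Continuous fun x => ∑ i, f x i ^ 2 := by
    have := hf.continuous
    fun_prop
  have hK : IsCompact (closedBall (0 : ι → ℝ) R) := isCompact_closedBall _ _
  have hKne : (closedBall (0 : ι → ℝ) R).Nonempty := ⟨0, by simp [hR0.le]⟩
  obtain ⟨x₀, -, hx₀⟩ := hK.exists_isMinOn hKne hfsq.continuousOn
  set c := ∑ i, f x₀ i ^ 2 with hc
  have hcpos : 0 < c := by
    obtain ⟨i, hi⟩ := Function.ne_iff.1 (hne x₀)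
    exact Finset.sum_pos' (fun i _ => sq_nonneg _) ⟨i, Finset.mem_univ _, by
      have : f x₀ i ≠ 0 := hi
      positivity⟩
  obtain ⟨C₁, hC₁⟩ := hK.exists_bound_of_continuousOn hfsq.continuousOn
  have hsq : Continuous fun x : ι → ℝ => ∑ i, x i ^ 2 := by fun_prop
  obtain ⟨C₂, hC₂⟩ := hK.exists_bound_of_continuousOn hsq.continuousOn
  set J : (ι → ℝ) → ℝ := fun x =>
    (ContinuousLinearMap.id ℝ (ι → ℝ) + fderiv ℝ (fun x => f x - x) x).det with hJ
  have hJc : Continuous J := ContinuousLinearMap.continuous_det.comp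
    (continuous_const.add (hh.continuous_fderiv one_ne_zero))
  obtain ⟨D, hD⟩ := hK.exists_bound_of_continuousOn hJc.continuousOn
  set C := max C₁ C₂ with hCdef
  have hCf : ∀ x ∈ closedBall (0 : ι → ℝ) R, ∑ i, f x i ^ 2 ≤ C := fun x hx =>
    (le_abs_self _).trans ((hC₁ x hx).trans (le_max_left _ _))
  have hCx : ∀ x ∈ closedBall (0 : ι → ℝ) R, ∑ i, x i ^ 2 ≤ C := fun x hx =>
    (le_abs_self _).trans ((hC₂ x hx).trans (le_max_right _ _))
  have hcC : c ≤ C := by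
    have h0 : (0 : ι → ℝ) ∈ closedBall (0 : ι → ℝ) R := by simp [hR0.le]
    exact (hx₀ h0).trans (hCf 0 h0)
  have hD0 : 0 ≤ D := (norm_nonneg _).trans (hD 0 (by simp [hR0.le]))
  set s : Set (ι → ℝ) := {x | ∑ i, x i ^ 2 < c / 2} ∩ ball 0 R with hs
  have hsopen : IsOpen s := (isOpen_lt hsq continuous_const).inter isOpen_ball
  have hsK : s ⊆ closedBall 0 R := Set.inter_subset_right.trans ball_subset_closedBall
  have hspos : 0 < volume.real s := by
    refine ENNReal.toReal_pos (hsopen.measure_pos volume ⟨0, by simp [hs, hR0, hcpos]⟩).ne' ?_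
    exact ((measure_mono hsK).trans_lt hK.measure_lt_top).ne
  set W := volume.real s
  set B := volume.real (closedBall (0 : ι → ℝ) R)
  have key : ∀ k : ℕ, (C - c / 2) ^ k * W ≤ D * (C - c) ^ k * B := by
    intro k
    have e := integral_kernel_comp hh (R := R) (fun x hx => by simp [hR x hx]) C k
    have hkc : Continuous fun x : ι → ℝ => (C - ∑ i, x i ^ 2) ^ k := by fun_prop
    have h1 : (C - c / 2) ^ k * W ≤ ∫ x in closedBall (0 : ι → ℝ) R, (C - ∑ i, x i ^ 2) ^ k := by
      calc (C - c / 2) ^ k * W = ∫ x in s, (C - c / 2) ^ k := by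
            rw [setIntegral_const, smul_eq_mul, mul_comm]
        _ ≤ ∫ x in s, (C - ∑ i, x i ^ 2) ^ k := by
            refine setIntegral_mono_on ?_ ?_ hsopen.measurableSet fun x hx => ?_
            · exact integrableOn_const ((measure_mono hsK).trans_lt hK.measure_lt_top).ne
            · exact (hkc.continuousOn.integrableOn_compact hK).mono_set hsK
            · have : ∑ i, x i ^ 2 < c / 2 := hx.1
              exact pow_le_pow_left₀ (by linarith) (by linarith) k
        _ ≤ _ := by
            refine setIntegral_mono_set (hkc.continuousOn.integrableOn_compact hK) ?_
              hsK.eventuallyLE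
            refine (ae_restrict_iff' measurableSet_closedBall).2 (Filter.Eventually.of_forall
              fun x hx => ?_)
            exact pow_nonneg (sub_nonneg.2 (hCx x hx)) k
    have h2 : ‖∫ x in closedBall (0 : ι → ℝ) R, J x * (C - ∑ i, (x i + (f x - x) i) ^ 2) ^ k‖
        ≤ D * (C - c) ^ k * B := by
      refine norm_setIntegral_le_of_norm_le_const hK.measure_lt_top fun x hx => ?_
      have h3 : c ≤ ∑ i, f x i ^ 2 := hx₀ hx
      have h4 := hCf x hx
      simp only [Pi.sub_apply, add_sub_cancel]
      rw [norm_mul, norm_pow, Real.norm_of_nonneg (sub_nonneg.2 h4)]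
      exact mul_le_mul (hD x hx) (pow_le_pow_left₀ (by linarith) (by linarith) k) (by
        have := sub_nonneg.2 h4; positivity) hD0
    rw [← e] at h1
    exact h1.trans ((le_abs_self _).trans h2)
  have hq : (C - c) / (C - c / 2) < 1 := by rw [div_lt_one (by linarith)]; linarith
  have hq0 : 0 ≤ (C - c) / (C - c / 2) := div_nonneg (by linarith) (by linarith)
  have hlim := ((tendsto_pow_atTop_nhds_zero_of_lt_one hq0 hq).const_mul D).mul_const B
  have hle : W ≤ D * 0 * B := by
    refine ge_of_tendsto' hlim fun k => ?_
    have hp : 0 < (C - c / 2) ^ k := pow_pos (by linarith) k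
    rw [div_pow, mul_div_assoc', div_mul_eq_mul_div, le_div_iff₀ hp, mul_comm]
    exact key k
  simp at hle
  linarith

end Brouwer

section Torus

open MeasureTheory

/-- The normalised Haar measure on the circle. -/
local instance : MeasureSpace UnitAddCircle := ⟨AddCircle.haarAddCircle⟩

local instance : Measure.IsAddHaarMeasure (volume : Measure UnitAddCircle) :=
  inferInstanceAs (Measure.IsAddHaarMeasure AddCircle.haarAddCircle)

local instance : IsProbabilityMeasure (volume : Measure UnitAddCircle) :=
  inferInstanceAs (IsProbabilityMeasure AddCircle.haarAddCircle)

open UnitAddTorus Pointwise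

variable {d : Type*} [Fintype d]

/-- The Hilbert space `L²` of the torus. -/
abbrev TorusL2 (d : Type*) [Fintype d] : Type _ := Lp ℂ 2 (volume : Measure (UnitAddTorus d))

/-- The inclusion of continuous functions on the torus in `L²`. -/
def toL2 : C(UnitAddTorus d, ℂ) →L[ℂ] TorusL2 d :=
  ContinuousMap.toLp 2 volume ℂ

lemma toL2_injective : Function.Injective (toL2 (d := d)) :=
  ContinuousMap.toLp_injective (𝕜 := ℂ) (p := 2) (volume : Measure (UnitAddTorus d))

lemma orthonormal_toL2_mFourier : Orthonormal ℂ fun k : d → ℤ => toL2 (mFourier k) :=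
  orthonormal_mFourier

lemma norm_toL2_sq (F : C(UnitAddTorus d, ℂ)) : ‖toL2 F‖ ^ 2 = ∫ x, ‖F x‖ ^ 2 := by
  have h := ContinuousMap.inner_toLp (𝕜 := ℂ) (volume : Measure (UnitAddTorus d)) F F
  have h1 : ((‖toL2 F‖ ^ 2 : ℝ) : ℂ) = ((∫ x, ‖F x‖ ^ 2 : ℝ) : ℂ) := by
    rw [← integral_complex_ofReal, Complex.ofReal_pow]
    refine (inner_self_eq_norm_sq_to_K (𝕜 := ℂ) (toL2 F)).symm.trans (h.trans
      (integral_congr_ae (Filter.Eventually.of_forall fun x => ?_)))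
    simp only [Complex.mul_conj, Complex.normSq_eq_norm_sq]
  exact_mod_cast h1

lemma integrable_norm_sq (F : C(UnitAddTorus d, ℂ)) :
    Integrable (fun x => ‖F x‖ ^ 2) (volume : Measure (UnitAddTorus d)) := by
  have hc : Continuous fun x => ‖F x‖ ^ 2 := by fun_prop
  exact hc.integrable_of_hasCompactSupport (HasCompactSupport.of_compactSpace _)

lemma norm_toL2_le_of_norm_le {F G : C(UnitAddTorus d, ℂ)} {c : ℝ} (hc : 0 ≤ c)
    (h : ∀ x, ‖F x‖ ≤ c * ‖G x‖) : ‖toL2 F‖ ≤ c * ‖toL2 G‖ := by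
  refine (sq_le_sq₀ (norm_nonneg _) (by positivity)).1 ?_
  rw [mul_pow, norm_toL2_sq, norm_toL2_sq, ← integral_const_mul]
  refine integral_mono (integrable_norm_sq F) ((integrable_norm_sq G).const_mul _) fun x => ?_
  simpa [mul_pow] using pow_le_pow_left₀ (norm_nonneg _) (h x) 2

lemma norm_toL2_mul_le (F G : C(UnitAddTorus d, ℂ)) : ‖toL2 (F * G)‖ ≤ ‖F‖ * ‖toL2 G‖ :=
  norm_toL2_le_of_norm_le (norm_nonneg _) fun x => by
    simpa using mul_le_mul_of_nonneg_right (F.norm_coe_le_norm x) (norm_nonneg (G x))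

lemma le_sum_norm_toL2_mul_sq {ι : Type*} [Fintype ι] {σ : ι → C(UnitAddTorus d, ℂ)} {c : ℝ}
    (h : ∀ x, c ≤ ∑ j, ‖σ j x‖ ^ 2) (F : C(UnitAddTorus d, ℂ)) :
    c * ‖toL2 F‖ ^ 2 ≤ ∑ j, ‖toL2 (σ j * F)‖ ^ 2 := by
  simp_rw [norm_toL2_sq]
  rw [← integral_const_mul, ← integral_finsetSum _ fun j _ => integrable_norm_sq _]
  refine integral_mono ((integrable_norm_sq F).const_mul _)
    (integrable_finsetSum _ fun j _ => integrable_norm_sq _) fun x => ?_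
  have := mul_le_mul_of_nonneg_right (h x) (sq_nonneg ‖F x‖)
  simpa [mul_pow, Finset.sum_mul] using this

lemma norm_mFourier_apply (k : d → ℤ) (x : UnitAddTorus d) : ‖mFourier k x‖ = 1 := by
  simp only [mFourier, ContinuousMap.coe_mk, fourier_apply, norm_prod, Circle.norm_coe,
    Finset.prod_const_one]

lemma norm_toL2_mFourier_mul (k : d → ℤ) (F : C(UnitAddTorus d, ℂ)) :
    ‖toL2 (mFourier k * F)‖ = ‖toL2 F‖ := by
  refine le_antisymm ?_ ?_
  · simpa using norm_toL2_le_of_norm_le (F := mFourier k * F) (G := F) zero_le_one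
      fun x => by simp [norm_mFourier_apply]
  · simpa using norm_toL2_le_of_norm_le (F := F) (G := mFourier k * F) zero_le_one
      fun x => by simp [norm_mFourier_apply]

/-- Trigonometric polynomials with frequencies in `Z`. -/
def trigPoly (Z : Set (d → ℤ)) : Submodule ℂ C(UnitAddTorus d, ℂ) :=
  Submodule.span ℂ (mFourier '' Z)

lemma mFourier_mem_trigPoly {Z : Set (d → ℤ)} {k : d → ℤ} (hk : k ∈ Z) : mFourier k ∈ trigPoly Z :=
  Submodule.subset_span ⟨k, hk, rfl⟩

lemma trigPoly_mono {Z W : Set (d → ℤ)} (h : Z ⊆ W) : trigPoly Z ≤ trigPoly W :=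
  Submodule.span_mono (Set.image_mono h)

lemma mul_mem_trigPoly {Z W : Set (d → ℤ)} {F G : C(UnitAddTorus d, ℂ)} (hF : F ∈ trigPoly Z)
    (hG : G ∈ trigPoly W) : F * G ∈ trigPoly (Z + W) := by
  have := Submodule.mul_mem_mul hF hG
  rw [trigPoly, trigPoly, Submodule.span_mul_span] at this
  refine Submodule.span_mono ?_ this
  rintro _ ⟨_, ⟨k, hk, rfl⟩, _, ⟨l, hl, rfl⟩, rfl⟩
  exact ⟨k + l, Set.add_mem_add hk hl, by ext x; simp [mFourier_add]⟩

lemma inner_toL2_eq_zero {Z W : Set (d → ℤ)} (hZW : Disjoint Z W) {F G : C(UnitAddTorus d, ℂ)}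
    (hF : F ∈ trigPoly Z) (hG : G ∈ trigPoly W) : inner ℂ (toL2 F) (toL2 G) = 0 := by
  induction hF using Submodule.span_induction with
  | mem F hF =>
    obtain ⟨k, hk, rfl⟩ := hF
    induction hG using Submodule.span_induction with
    | mem G hG =>
      obtain ⟨l, hl, rfl⟩ := hG
      exact orthonormal_toL2_mFourier.2 (hZW.ne_of_mem hk hl)
    | zero => simp
    | add x y _ _ hx hy => rw [map_add, inner_add_right, hx, hy, add_zero]
    | smul c x _ hx => rw [map_smul, inner_smul_right, hx, mul_zero]
  | zero => simp
  | add x y _ _ hx hy => rw [map_add, inner_add_left, hx, hy, add_zero]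
  | smul c x _ hx => rw [map_smul, inner_smul_left, hx, mul_zero]

lemma norm_toL2_le_norm_toL2_add {Z W : Set (d → ℤ)} (hZW : Disjoint Z W)
    {F G : C(UnitAddTorus d, ℂ)} (hF : F ∈ trigPoly Z) (hG : G ∈ trigPoly W) :
    ‖toL2 F‖ ≤ ‖toL2 (F + G)‖ := by
  have := norm_add_sq_eq_norm_sq_add_norm_sq_of_inner_eq_zero _ _ (inner_toL2_eq_zero hZW hF hG)
  rw [map_add]
  nlinarith [norm_nonneg (toL2 F), norm_nonneg (toL2 G), norm_nonneg (toL2 F + toL2 G)]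

lemma exists_box_of_mem_trigPoly_univ {F : C(UnitAddTorus d, ℂ)} (hF : F ∈ trigPoly Set.univ) :
    ∃ K : ℕ, F ∈ trigPoly {k : d → ℤ | ∀ i, |k i| ≤ K} := by
  induction hF using Submodule.span_induction with
  | mem F hF =>
    obtain ⟨k, -, rfl⟩ := hF
    refine ⟨∑ i, (k i).natAbs, mFourier_mem_trigPoly fun i => ?_⟩
    rw [Int.abs_eq_natAbs]
    exact_mod_cast Finset.single_le_sum (f := fun i => (k i).natAbs) (fun _ _ => Nat.zero_le _)
      (Finset.mem_univ i)
  | zero => exact ⟨0, zero_mem _⟩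
  | add x y _ _ hx hy =>
    obtain ⟨K, hK⟩ := hx
    obtain ⟨L, hL⟩ := hy
    refine ⟨max K L, add_mem (trigPoly_mono (fun k hk i => ?_) hK)
      (trigPoly_mono (fun k hk i => ?_) hL)⟩
    · exact (hk i).trans (by exact_mod_cast le_max_left _ _)
    · exact (hk i).trans (by exact_mod_cast le_max_right _ _)
  | smul c x _ hx => exact hx.imp fun K hK => Submodule.smul_mem _ c hK

lemma dense_trigPoly_univ :
    Dense (trigPoly (Set.univ : Set (d → ℤ)) : Set C(UnitAddTorus d, ℂ)) := by
  rw [Submodule.dense_iff_topologicalClosure_eq_top, trigPoly, Set.image_univ]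
  exact span_mFourier_closure_eq_top

/-- Approximate joint eigenvectors of multiplication operators. -/
lemma exists_trigPoly_concentrated {ι : Type*} [Fintype ι] (σ : ι → C(UnitAddTorus d, ℂ))
    (x₀ : UnitAddTorus d) {η : ℝ} (hη : 0 < η) :
    ∃ F ∈ trigPoly (Set.univ : Set (d → ℤ)), toL2 F ≠ 0 ∧
      ∀ j, ‖toL2 (σ j * F - σ j x₀ • F)‖ ≤ η * ‖toL2 F‖ := by
  obtain ⟨r, hr, hσ⟩ : ∃ r > 0, ∀ x, dist x x₀ < r → ∀ j, ‖σ j x - σ j x₀‖ < η / 2 := by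
    have : ∀ᶠ x in nhds x₀, ∀ j, ‖σ j x - σ j x₀‖ < η / 2 := by
      refine Filter.eventually_all.2 fun j => ?_
      have hc : Continuous fun x => ‖σ j x - σ j x₀‖ := by fun_prop
      exact hc.continuousAt.eventually (gt_mem_nhds (by simpa using half_pos hη))
    exact Metric.eventually_nhds_iff.1 this
  let G : C(UnitAddTorus d, ℂ) := ⟨fun x => ((max 0 (r - dist x x₀) : ℝ) : ℂ), by fun_prop⟩
  have hG : toL2 G ≠ 0 := by
    rw [← map_zero toL2]
    refine toL2_injective.ne fun h => ?_
    have := DFunLike.congr_fun h x₀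
    simp [G] at this
    linarith
  have hGσ : ∀ j, ‖toL2 (σ j * G - σ j x₀ • G)‖ ≤ η / 2 * ‖toL2 G‖ := by
    intro j
    refine norm_toL2_le_of_norm_le (half_pos hη).le fun x => ?_
    rw [ContinuousMap.sub_apply, ContinuousMap.mul_apply, ContinuousMap.smul_apply, smul_eq_mul,
      ← sub_mul, norm_mul]
    by_cases hx : dist x x₀ < r
    · exact mul_le_mul_of_nonneg_right (hσ x hx j).le (norm_nonneg _)
    · have : G x = 0 := by simp [G, not_lt.1 hx]
      simp [this]
  have hU : IsOpen ({F : C(UnitAddTorus d, ℂ) | toL2 F ≠ 0} ∩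
      ⋂ j, {F | ‖toL2 (σ j * F - σ j x₀ • F)‖ < η * ‖toL2 F‖}) := by
    refine (isOpen_ne_fun toL2.continuous continuous_const).inter
      (isOpen_iInter_of_finite fun j => ?_)
    refine isOpen_lt (toL2.continuous.comp ?_).norm (toL2.continuous.norm.const_mul _)
    exact (continuous_const.mul continuous_id).sub (continuous_const_smul _)
  obtain ⟨F, hF, hFT⟩ := dense_trigPoly_univ.inter_open_nonempty _ hU ⟨G, hG,
    Set.mem_iInter.2 fun j => (hGσ j).trans_lt (by nlinarith [norm_pos_iff.2 hG])⟩
  exact ⟨F, hFT, hF.1, fun j => le_of_lt (Set.mem_iInter.1 hF.2 j)⟩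

lemma contDiff_comp_coe_of_mem_trigPoly {F : C(UnitAddTorus d, ℂ)} {Z : Set (d → ℤ)}
    (hF : F ∈ trigPoly Z) :
    ContDiff ℝ 1 fun x : d → ℝ => F fun i => (x i : UnitAddCircle) := by
  induction hF using Submodule.span_induction with
  | mem F hF =>
    obtain ⟨k, -, rfl⟩ := hF
    simp only [mFourier, ContinuousMap.coe_mk, fourier_coe_apply]
    refine contDiff_prod fun i _ => ?_
    refine Complex.contDiff_exp.comp ?_ |>.of_le le_top
    refine ContDiff.div_const (contDiff_const.mul ?_) _
    exact Complex.ofRealCLM.contDiff.comp (contDiff_apply ℝ ℝ i)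
  | zero => exact contDiff_const
  | add x y _ _ hx hy => exact hx.add hy
  | smul c x _ hx => exact hx.const_smul c

end Torus

open UnitAddTorus Pointwise

section Shifts

variable {n : ℕ}

lemma inner_delta_left (z : Fin n → ℕ) (x : Hn n) : inner ℂ (delta z) x = x z := by
  rw [delta, lp.inner_single_left]
  simp

lemma delta_apply (z w : Fin n → ℕ) : (delta z : Hn n) w = if w = z then 1 else 0 := by
  rw [delta, lp.single_apply]
  split_ifs with h
  · subst h; simp
  · simp [h]

lemma orthonormal_delta : Orthonormal ℂ (delta (n := n)) := by
  rw [orthonormal_iff_ite]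
  intro z w
  rw [inner_delta_left, delta_apply]

/-- The isometry of `ℓ²(ℕ^n)` carrying the standard basis to a given orthonormal family. -/
def isometryOfOrthonormal {E : Type*} [NormedAddCommGroup E] [InnerProductSpace ℂ E]
    [CompleteSpace E] {v : (Fin n → ℕ) → E} (hv : Orthonormal ℂ v) : Hn n →ₗᵢ[ℂ] E :=
  hv.orthogonalFamily.linearIsometry

lemma isometryOfOrthonormal_delta {E : Type*} [NormedAddCommGroup E] [InnerProductSpace ℂ E]
    [CompleteSpace E] {v : (Fin n → ℕ) → E} (hv : Orthonormal ℂ v) (z : Fin n → ℕ) :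
    isometryOfOrthonormal hv (delta z) = v z := by
  refine (OrthogonalFamily.linearIsometry_apply_single hv.orthogonalFamily (i := z) 1).trans ?_
  simp

/-- The shift by `k`, `δ_z ↦ δ_{z + k}`. -/
def shiftBy (k : Fin n → ℕ) : Hn n →L[ℂ] Hn n :=
  (isometryOfOrthonormal (orthonormal_delta.comp (fun z : Fin n → ℕ => z + k)
    (add_left_injective k))).toContinuousLinearMap

lemma shiftBy_delta (k z : Fin n → ℕ) : shiftBy k (delta z) = delta (z + k) :=
  isometryOfOrthonormal_delta
    (orthonormal_delta.comp (fun z : Fin n → ℕ => z + k) (add_left_injective k)) z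

open Classical in
lemma star_apply_delta {k : Fin n → ℕ} {T : Hn n →L[ℂ] Hn n}
    (hT : ∀ z, T (delta z) = delta (z + k)) (z : Fin n → ℕ) :
    star T (delta z) = if k ≤ z then delta (z - k) else 0 := by
  refine lp.ext (funext fun w => ?_)
  rw [← inner_delta_left, ContinuousLinearMap.star_eq_adjoint,
    ContinuousLinearMap.adjoint_inner_right, hT, inner_delta_left, delta_apply]
  split_ifs with h1 h2 h2
  · subst h1; simp [delta_apply]
  · exact absurd (h1 ▸ le_add_self) h2
  · rw [delta_apply, if_neg]
    rintro rfl
    exact h1 (tsub_add_cancel_of_le h2)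
  · rfl

/-- The Fourier transform, `δ_z ↦ e^{2πi z·x}`. -/
def fourierH : Hn n →ₗᵢ[ℂ] TorusL2 (Fin n) :=
  isometryOfOrthonormal (v := fun z : Fin n → ℕ => toL2 (mFourier fun i => (z i : ℤ)))
    (orthonormal_toL2_mFourier.comp (fun (z : Fin n → ℕ) i => (z i : ℤ))
      fun z w h => funext fun i => by simpa using congr_fun h i)

lemma fourierH_delta (z : Fin n → ℕ) :
    fourierH (delta z) = toL2 (mFourier fun i => (z i : ℤ)) :=
  isometryOfOrthonormal_delta _ z

/-- Finitely supported vectors with support in `Z`. -/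
def finSupp (Z : Set (Fin n → ℕ)) : Submodule ℂ (Hn n) := Submodule.span ℂ (delta '' Z)

lemma delta_mem_finSupp {Z : Set (Fin n → ℕ)} {z : Fin n → ℕ} (hz : z ∈ Z) :
    delta z ∈ finSupp Z := Submodule.subset_span ⟨z, hz, rfl⟩

lemma finSupp_mono {Z W : Set (Fin n → ℕ)} (h : Z ⊆ W) : finSupp Z ≤ finSupp W :=
  Submodule.span_mono (Set.image_mono h)

lemma dense_finSupp_univ : Dense (finSupp (Set.univ : Set (Fin n → ℕ)) : Set (Hn n)) := by
  intro x
  refine mem_closure_of_tendsto (lp.hasSum_single (p := 2) (by simp) x)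
    (Filter.Eventually.of_forall fun s => ?_)
  refine Submodule.sum_mem _ fun z _ => ?_
  have : lp.single 2 z (x z) = x z • (delta z : Hn n) := by
    rw [delta, ← lp.single_smul]; simp
  rw [this]
  exact Submodule.smul_mem _ _ (delta_mem_finSupp (Set.mem_univ z))

lemma map_mem_finSupp {Z W : Set (Fin n → ℕ)} {a : Hn n →L[ℂ] Hn n}
    (h : ∀ z ∈ Z, a (delta z) ∈ finSupp W) {y : Hn n} (hy : y ∈ finSupp Z) : a y ∈ finSupp W := by
  induction hy using Submodule.span_induction with
  | mem y hy => obtain ⟨z, hz, rfl⟩ := hy; exact h z hz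
  | zero => simp
  | add x y _ _ hx hy => rw [map_add]; exact add_mem hx hy
  | smul c x _ hx => rw [map_smul]; exact Submodule.smul_mem _ c hx

/-- On `Z` the operator `a` acts as multiplication by `σ` in the Fourier picture. -/
lemma exists_fourierH_eq {Z : Set (Fin n → ℕ)} {a : Hn n →L[ℂ] Hn n}
    {σ : C(UnitAddTorus (Fin n), ℂ)}
    (h : ∀ z ∈ Z, fourierH (a (delta z)) = toL2 (σ * mFourier fun i => (z i : ℤ)))
    {y : Hn n} (hy : y ∈ finSupp Z) :
    ∃ F ∈ trigPoly ((fun (z : Fin n → ℕ) i => (z i : ℤ)) '' Z),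
      fourierH y = toL2 F ∧ fourierH (a y) = toL2 (σ * F) := by
  induction hy using Submodule.span_induction with
  | mem y hy =>
    obtain ⟨z, hz, rfl⟩ := hy
    exact ⟨_, mFourier_mem_trigPoly ⟨z, hz, rfl⟩, fourierH_delta z, h z hz⟩
  | zero => exact ⟨0, zero_mem _, by simp, by simp⟩
  | add x y _ _ hx hy =>
    obtain ⟨F, hF, hF1, hF2⟩ := hx
    obtain ⟨G, hG, hG1, hG2⟩ := hy
    exact ⟨F + G, add_mem hF hG, by simp [hF1, hG1], by simp [hF2, hG2, mul_add]⟩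
  | smul c x _ hx =>
    obtain ⟨F, hF, hF1, hF2⟩ := hx
    exact ⟨c • F, Submodule.smul_mem _ c hF, by simp [hF1], by
      rw [map_smul, map_smul, hF2, mul_smul_comm, map_smul]⟩

lemma exists_toL2_eq_fourierH {Z : Set (Fin n → ℕ)} {y : Hn n} (hy : y ∈ finSupp Z) :
    ∃ F ∈ trigPoly ((fun (z : Fin n → ℕ) i => (z i : ℤ)) '' Z), fourierH y = toL2 F := by
  obtain ⟨F, hF, h, -⟩ := exists_fourierH_eq (a := 1) (σ := 1)
    (fun z _ => by simp [fourierH_delta]) hy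
  exact ⟨F, hF, h⟩

lemma fourierH_shiftBy {k : Fin n → ℕ} {y : Hn n} {Z : Set (Fin n → ℕ)} (hy : y ∈ finSupp Z)
    {F : C(UnitAddTorus (Fin n), ℂ)} (hF : fourierH y = toL2 F) :
    fourierH (shiftBy k y) = toL2 ((mFourier fun i => (k i : ℤ)) * F) := by
  obtain ⟨G, -, hG, hG'⟩ := exists_fourierH_eq (a := shiftBy k)
    (σ := mFourier fun i => (k i : ℤ)) (fun z _ => by
      rw [shiftBy_delta, fourierH_delta]
      congr 1
      ext x
      rw [ContinuousMap.mul_apply, ← mFourier_add]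
      congr 2
      ext i
      simp [add_comm]) hy
  rwa [toL2_injective (hF.symm.trans hG)]

/-- Lattice points all of whose coordinates are at least `K`. -/
def highSet (n K : ℕ) : Set (Fin n → ℕ) := {z | ∀ i, K ≤ z i}

/-- Lattice points with some coordinate smaller than `M`. -/
def lowSet (n M : ℕ) : Set (Fin n → ℕ) := {z | ∃ i, z i < M}

/-- Integer vectors with entries of absolute value at most `N`. -/
def boxSet (n N : ℕ) : Set (Fin n → ℤ) := {k | ∀ i, |k i| ≤ N}

/-- `a` has propagation at most `N` and, at distance at least `N` from the boundary of `ℕ^n`, acts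
as multiplication by the trigonometric polynomial `σ`. -/
structure HasSymbol (a : Hn n →L[ℂ] Hn n) (σ : C(UnitAddTorus (Fin n), ℂ)) (N : ℕ) : Prop where
  mem_trigPoly : σ ∈ trigPoly (boxSet n N)
  high : ∀ K, ∀ z ∈ highSet n (K + N), a (delta z) ∈ finSupp (highSet n K)
  low : ∀ M, ∀ z ∈ lowSet n M, a (delta z) ∈ finSupp (lowSet n (M + N))
  fourier : ∀ z ∈ highSet n N, fourierH (a (delta z)) = toL2 (σ * mFourier fun i => (z i : ℤ))

lemma highSet_anti {K L : ℕ} (h : K ≤ L) : highSet n L ⊆ highSet n K := fun _ hz i => h.trans (hz i)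

lemma lowSet_mono {K L : ℕ} (h : K ≤ L) : lowSet n K ⊆ lowSet n L :=
  fun _ hz => hz.imp fun _ hi => hi.trans_le h

lemma boxSet_mono {K L : ℕ} (h : K ≤ L) : boxSet n K ⊆ boxSet n L :=
  fun _ hk i => (hk i).trans (by exact_mod_cast h)

namespace HasSymbol

variable {a b : Hn n →L[ℂ] Hn n} {σ τ : C(UnitAddTorus (Fin n), ℂ)} {N L : ℕ}

lemma mono (h : HasSymbol a σ N) (hNL : N ≤ L) : HasSymbol a σ L where
  mem_trigPoly := trigPoly_mono (boxSet_mono hNL) h.mem_trigPoly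
  high K z hz := h.high K z (highSet_anti (by omega) hz)
  low M z hz := finSupp_mono (lowSet_mono (by omega)) (h.low M z hz)
  fourier z hz := h.fourier z (highSet_anti hNL hz)

lemma add_same (ha : HasSymbol a σ N) (hb : HasSymbol b τ N) : HasSymbol (a + b) (σ + τ) N where
  mem_trigPoly := add_mem ha.mem_trigPoly hb.mem_trigPoly
  high K z hz := add_mem (ha.high K z hz) (hb.high K z hz)
  low M z hz := add_mem (ha.low M z hz) (hb.low M z hz)
  fourier z hz := by simp [ha.fourier z hz, hb.fourier z hz, add_mul]

lemma add (ha : HasSymbol a σ N) (hb : HasSymbol b τ L) :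
    HasSymbol (a + b) (σ + τ) (max N L) :=
  (ha.mono (le_max_left _ _)).add_same (hb.mono (le_max_right _ _))

lemma smul (c : ℂ) (ha : HasSymbol a σ N) : HasSymbol (c • a) (c • σ) N where
  mem_trigPoly := Submodule.smul_mem _ c ha.mem_trigPoly
  high K z hz := Submodule.smul_mem _ c (ha.high K z hz)
  low M z hz := Submodule.smul_mem _ c (ha.low M z hz)
  fourier z hz := by
    rw [_root_.smul_apply, map_smul, ha.fourier z hz, smul_mul_assoc, map_smul]

lemma one : HasSymbol (1 : Hn n →L[ℂ] Hn n) 1 0 where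
  mem_trigPoly := by
    rw [← mFourier_zero]
    exact mFourier_mem_trigPoly fun i => by simp
  high K z hz := delta_mem_finSupp hz
  low M z hz := delta_mem_finSupp hz
  fourier z hz := by simp [fourierH_delta]

lemma mul (ha : HasSymbol a σ N) (hb : HasSymbol b τ L) : HasSymbol (a * b) (σ * τ) (N + L) where
  mem_trigPoly := by
    refine trigPoly_mono ?_ (mul_mem_trigPoly ha.mem_trigPoly hb.mem_trigPoly)
    rintro _ ⟨k, hk, l, hl, rfl⟩ i
    push_cast
    exact (abs_add_le _ _).trans (add_le_add (hk i) (hl i))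
  high K z hz := map_mem_finSupp (ha.high K) (hb.high (K + N) z (by rwa [add_assoc]))
  low M z hz := by
    have := map_mem_finSupp (ha.low (M + L)) (hb.low M z hz)
    rwa [add_assoc, add_comm L N] at this
  fourier z hz := by
    obtain ⟨F, -, hF, hF'⟩ := exists_fourierH_eq ha.fourier (hb.high N z hz)
    rw [hb.fourier z (highSet_anti le_add_self hz)] at hF
    rw [mul_apply_eq_comp, hF', ← toL2_injective hF, mul_assoc]

lemma of_isShift {i : Fin n} {T : Hn n →L[ℂ] Hn n} (hT : IsShift i T) :
    HasSymbol T (mFourier (Pi.single i 1)) 1 where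
  mem_trigPoly := mFourier_mem_trigPoly fun j => by
    rw [Pi.single_apply]; split_ifs <;> simp
  high K z hz := by
    rw [hT z]
    refine delta_mem_finSupp fun j => ?_
    have := hz j
    rw [Function.update_apply]
    split_ifs with h
    · subst h; omega
    · omega
  low M z hz := by
    rw [hT z]
    obtain ⟨j, hj⟩ := hz
    refine delta_mem_finSupp ⟨j, ?_⟩
    rw [Function.update_apply]
    split_ifs with h
    · subst h; omega
    · omega
  fourier z hz := by
    rw [hT z, fourierH_delta]
    congr 1
    ext x
    rw [ContinuousMap.mul_apply, ← mFourier_add]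
    congr 2
    ext j
    by_cases h : j = i
    · subst h; simp [add_comm]
    · simp [h]

lemma star_of_isShift {i : Fin n} {T : Hn n →L[ℂ] Hn n} (hT : IsShift i T) :
    HasSymbol (star T) (mFourier (-Pi.single i 1)) 1 := by
  have hT' : ∀ z, T (delta z) = delta (z + Pi.single i 1) := fun z => by
    rw [hT z]
    congr 1
    ext j
    by_cases h : j = i
    · subst h; simp
    · simp [h]
  have hle : ∀ z : Fin n → ℕ, Pi.single i 1 ≤ z ↔ 1 ≤ z i := fun z => by
    refine ⟨fun h => by simpa using h i, fun h j => ?_⟩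
    by_cases hj : j = i
    · subst hj; simpa using h
    · simp [hj]
  have hsub : ∀ (z : Fin n → ℕ) j, (z - Pi.single i 1 : Fin n → ℕ) j = if j = i then z j - 1 else z j :=
    fun z j => by
      by_cases hj : j = i
      · subst hj; simp
      · simp [hj]
  refine ⟨mFourier_mem_trigPoly fun j => ?_, fun K z hz => ?_, fun M z hz => ?_, fun z hz => ?_⟩
  · rw [Pi.neg_apply, abs_neg, Pi.single_apply]; split_ifs <;> simp
  · rw [star_apply_delta hT', if_pos ((hle z).2 (by have := hz i; omega))]
    refine delta_mem_finSupp fun j => ?_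
    have := hz j
    rw [hsub]
    split_ifs <;> omega
  · rw [star_apply_delta hT']
    split_ifs
    · obtain ⟨j, hj⟩ := hz
      refine delta_mem_finSupp ⟨j, ?_⟩
      rw [hsub]
      split_ifs <;> omega
    · exact zero_mem _
  · rw [star_apply_delta hT', if_pos ((hle z).2 (hz i)), fourierH_delta]
    congr 1
    ext x
    rw [ContinuousMap.mul_apply, ← mFourier_add]
    congr 2
    ext j
    rw [hsub]
    by_cases h : j = i
    · subst h
      have := hz j
      simp only [if_true, Pi.add_apply, Pi.neg_apply, Pi.single_eq_same]
      omega
    · simp [h]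

end HasSymbol

/-- The algebra generated by the shifts. -/
def polyToeplitz (n : ℕ) : StarSubalgebra ℂ (Hn n →L[ℂ] Hn n) :=
  StarAlgebra.adjoin ℂ {T : Hn n →L[ℂ] Hn n | ∃ i : Fin n, IsShift i T}

lemma exists_hasSymbol {a : Hn n →L[ℂ] Hn n} (ha : a ∈ polyToeplitz n) :
    ∃ σ N, HasSymbol a σ N := by
  have ha' : a ∈ (polyToeplitz n).toSubalgebra := ha
  rw [polyToeplitz, StarAlgebra.adjoin_toSubalgebra] at ha'
  clear ha
  induction ha' using Algebra.adjoin_induction with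
  | mem T hT =>
    rcases hT with ⟨i, hT⟩ | ⟨i, hT⟩
    · exact ⟨_, _, .of_isShift hT⟩
    · have := HasSymbol.star_of_isShift hT
      rw [star_star] at this
      exact ⟨_, _, this⟩
  | algebraMap c =>
    rw [Algebra.algebraMap_eq_smul_one]
    exact ⟨_, _, HasSymbol.one.smul c⟩
  | add a b _ _ ha hb =>
    obtain ⟨σ, N, h⟩ := ha
    obtain ⟨τ, L, h'⟩ := hb
    exact ⟨_, _, h.add h'⟩
  | mul a b _ _ ha hb =>
    obtain ⟨σ, N, h⟩ := ha
    obtain ⟨τ, L, h'⟩ := hb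
    exact ⟨_, _, h.mul h'⟩

lemma polyToeplitz_le : polyToeplitz n ≤ Toeplitz n := StarSubalgebra.le_topologicalClosure _

lemma shiftBy_single_isShift (i : Fin n) : IsShift i (shiftBy (Pi.single i 1)) := fun z => by
  rw [shiftBy_delta]
  congr 1
  ext j
  by_cases h : j = i
  · subst h; simp
  · simp [h]

lemma ext_delta {S T : Hn n →L[ℂ] Hn n} (h : ∀ z, S (delta z) = T (delta z)) : S = T := by
  refine ContinuousLinearMap.ext_on (s := Set.range delta) ?_ (by rintro _ ⟨z, rfl⟩; exact h z)
  rw [← Set.image_univ]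
  exact dense_finSupp_univ

lemma shiftBy_mem (k : Fin n → ℕ) : shiftBy k ∈ polyToeplitz n := by
  let A : AddSubmonoid (Fin n → ℕ) :=
    { carrier := {k | shiftBy k ∈ polyToeplitz n}
      zero_mem' := by
        have : shiftBy (0 : Fin n → ℕ) = 1 := ext_delta fun z => by simp [shiftBy_delta]
        show shiftBy 0 ∈ polyToeplitz n
        rw [this]; exact one_mem _
      add_mem' := fun {k l} hk hl => by
        have : shiftBy (k + l) = shiftBy k * shiftBy l := ext_delta fun z => by
          simp [shiftBy_delta, add_comm k l, add_assoc]
        show shiftBy (k + l) ∈ polyToeplitz n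
        rw [this]; exact mul_mem hk hl }
  have : k = ∑ i, k i • Pi.single i 1 := by
    ext j; simp [Finset.sum_apply, Pi.single_apply]
  show k ∈ A
  rw [this]
  exact A.sum_mem fun i _ => A.nsmul_mem
    (StarAlgebra.subset_adjoin ℂ _ ⟨i, shiftBy_single_isShift i⟩) _

end Shifts

section LeftInverse

variable {n : ℕ} {ι : Type*} [Fintype ι]

lemma isClosed_toeplitz : IsClosed (Toeplitz n : Set (Hn n →L[ℂ] Hn n)) :=
  StarSubalgebra.isClosed_topologicalClosure _

/-- A finite family in the Toeplitz algebra which is jointly bounded below generates it as a left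
ideal. -/
lemma exists_sum_mul_eq_one (b : ι → Toeplitz n) {C : ℝ}
    (h : ∀ x : Hn n, ‖x‖ ≤ C * ∑ j, ‖(b j : Hn n →L[ℂ] Hn n) x‖) :
    ∃ b' : ι → Toeplitz n, ∑ j, b' j * b j = 1 := by
  set c : ℝ := (C ^ 2 * Fintype.card ι + 1)⁻¹ with hc
  have hc0 : 0 < c := by positivity
  have hbound : ∀ x : Hn n, c * ‖x‖ ^ 2 ≤ ∑ j, ‖(b j : Hn n →L[ℂ] Hn n) x‖ ^ 2 := fun x => by
    set s := ∑ j, ‖(b j : Hn n →L[ℂ] Hn n) x‖ ^ 2 with hs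
    have hs0 : 0 ≤ s := Finset.sum_nonneg fun j _ => by positivity
    have h1 : ‖x‖ ^ 2 ≤ C ^ 2 * (∑ j, ‖(b j : Hn n →L[ℂ] Hn n) x‖) ^ 2 := by
      rw [← mul_pow]
      exact pow_le_pow_left₀ (norm_nonneg _) (h x) 2
    have h2 : (∑ j, ‖(b j : Hn n →L[ℂ] Hn n) x‖) ^ 2 ≤ Fintype.card ι * s :=
      sq_sum_le_card_mul_sum_sq
    have h3 : ‖x‖ ^ 2 ≤ (C ^ 2 * Fintype.card ι + 1) * s := by
      nlinarith [mul_le_mul_of_nonneg_left h2 (sq_nonneg C)]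
    rw [hc, inv_mul_le_iff₀ (by positivity)]
    exact h3
  set D : Toeplitz n := ∑ j, star (b j) * b j with hD
  have hinner : ∀ x : Hn n, inner ℂ ((D : Hn n →L[ℂ] Hn n) x) x =
      ((∑ j, ‖(b j : Hn n →L[ℂ] Hn n) x‖ ^ 2 : ℝ) : ℂ) := fun x => by
    have hDc : (D : Hn n →L[ℂ] Hn n) =
        ∑ j, star (b j : Hn n →L[ℂ] Hn n) * (b j : Hn n →L[ℂ] Hn n) := by simp [hD]
    rw [hDc, _root_.sum_apply, sum_inner, Complex.ofReal_sum]
    refine Finset.sum_congr rfl fun j _ => ?_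
    rw [mul_apply_eq_comp, ContinuousLinearMap.star_eq_adjoint,
      ContinuousLinearMap.adjoint_inner_left, inner_self_eq_norm_sq_to_K, Complex.ofReal_pow]
    rfl
  have hle : (c : ℂ) • (1 : Hn n →L[ℂ] Hn n) ≤ D := by
    rw [ContinuousLinearMap.le_def, ContinuousLinearMap.isPositive_iff_complex]
    intro x
    have : inner ℂ (((D : Hn n →L[ℂ] Hn n) - (c : ℂ) • (1 : Hn n →L[ℂ] Hn n)) x) x =
        ((∑ j, ‖(b j : Hn n →L[ℂ] Hn n) x‖ ^ 2 - c * ‖x‖ ^ 2 : ℝ) : ℂ) := by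
      rw [sub_apply, inner_sub_left, hinner, smul_apply, one_apply_eq_self, inner_smul_left,
        inner_self_eq_norm_sq_to_K]
      push_cast
      simp
    rw [this]
    exact ⟨rfl, sub_nonneg.2 (hbound x)⟩
  have hpos : IsStrictlyPositive ((c : ℂ) • (1 : Hn n →L[ℂ] Hn n)) := by
    rw [IsStrictlyPositive.iff_of_unital]
    constructor
    · rw [ContinuousLinearMap.nonneg_iff_isPositive]
      exact ContinuousLinearMap.isPositive_one.smul_of_nonneg (by exact_mod_cast hc0.le)
    · exact (isUnit_one.smul (Units.mk0 (c : ℂ) (by exact_mod_cast hc0.ne')))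
  have hunit : IsUnit D := by
    have := isClosed_toeplitz (n := n)
    exact (StarSubalgebra.coe_isUnit (Toeplitz n)).1 (CStarAlgebra.isUnit_of_le _ hle hpos)
  obtain ⟨u, hu⟩ := hunit
  refine ⟨fun j => ↑u⁻¹ * star (b j), ?_⟩
  simp_rw [mul_assoc]
  rw [← Finset.mul_sum, ← hD, ← hu, Units.inv_mul]

lemma exists_polyToeplitz_near (a : Toeplitz n) {ε : ℝ} (hε : 0 < ε) :
    ∃ a' ∈ polyToeplitz n, ‖(a : Hn n →L[ℂ] Hn n) - a'‖ < ε := by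
  have : (a : Hn n →L[ℂ] Hn n) ∈ closure (polyToeplitz n : Set (Hn n →L[ℂ] Hn n)) := a.2
  obtain ⟨a', ha', h⟩ := Metric.mem_closure_iff.1 this ε hε
  exact ⟨a', ha', by rwa [← dist_eq_norm]⟩

/-- For an operator with symbol `σ`, vectors concentrated in frequency space near a point of the
torus and supported far away from the boundary are approximate eigenvectors. -/
lemma exists_approx_eigenvector {a : ι → Hn n →L[ℂ] Hn n} {σ : ι → C(UnitAddTorus (Fin n), ℂ)}
    {N : ℕ} (h : ∀ j, HasSymbol (a j) (σ j) N) (x₀ : UnitAddTorus (Fin n)) {η : ℝ} (hη : 0 < η) :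
    ∃ y : Hn n, y ≠ 0 ∧ ∀ j, ‖a j y - σ j x₀ • y‖ ≤ η * ‖y‖ := by
  obtain ⟨F, hF, hF0, hFη⟩ := exists_trigPoly_concentrated σ x₀ hη
  obtain ⟨K, hK⟩ := exists_box_of_mem_trigPoly_univ hF
  set e : C(UnitAddTorus (Fin n), ℂ) := mFourier fun _ => ((K + N : ℕ) : ℤ) with he
  have hmem : e * F ∈ trigPoly ((fun (z : Fin n → ℕ) i => (z i : ℤ)) '' highSet n N) := by
    refine trigPoly_mono ?_ (mul_mem_trigPoly (mFourier_mem_trigPoly rfl) hK)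
    rintro _ ⟨_, rfl, k, hk, rfl⟩
    have hk' : ∀ i, -(K : ℤ) ≤ k i := fun i => (abs_le.1 (hk i)).1
    refine ⟨fun i => ((K + N : ℕ) + k i).toNat, fun i => ?_, funext fun i => ?_⟩
    · have := hk' i
      show N ≤ ((K + N : ℕ) + k i).toNat
      omega
    · have := hk' i
      simp only [Pi.add_apply]
      omega
  have key : ∀ G ∈ trigPoly ((fun (z : Fin n → ℕ) i => (z i : ℤ)) '' highSet n N),
      ∃ y : Hn n, fourierH y = toL2 G ∧ ∀ j, fourierH (a j y) = toL2 (σ j * G) := fun G hG => by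
    induction hG using Submodule.span_induction with
    | mem G hG =>
      obtain ⟨_, ⟨z, hz, rfl⟩, rfl⟩ := hG
      exact ⟨delta z, fourierH_delta z, fun j => (h j).fourier z hz⟩
    | zero => exact ⟨0, by simp, fun j => by simp⟩
    | add G H _ _ hG hH =>
      obtain ⟨y, hy, hy'⟩ := hG
      obtain ⟨w, hw, hw'⟩ := hH
      exact ⟨y + w, by simp [hy, hw], fun j => by simp [hy', hw', mul_add]⟩
    | smul c G _ hG =>
      obtain ⟨y, hy, hy'⟩ := hG
      exact ⟨c • y, by simp [hy], fun j => by
        rw [map_smul, map_smul, hy', mul_smul_comm, map_smul]⟩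
  obtain ⟨y, hy, hy'⟩ := key _ hmem
  have hnorm : ‖y‖ = ‖toL2 F‖ := by
    rw [← fourierH.norm_map y, hy, he, norm_toL2_mFourier_mul]
  refine ⟨y, fun h0 => hF0 ?_, fun j => ?_⟩
  · rw [← norm_eq_zero, ← hnorm, h0, norm_zero]
  · rw [← fourierH.norm_map, map_sub, map_smul, hy', hy, ← map_smul, ← map_sub, hnorm]
    have : σ j * (e * F) - σ j x₀ • (e * F) = e * (σ j * F - σ j x₀ • F) := by
      rw [mul_sub, mul_smul_comm, mul_left_comm]
    rw [this, he, norm_toL2_mFourier_mul]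
    exact hFη j

lemma HasSymbol.norm_apply_le {a : Hn n →L[ℂ] Hn n} {σ : C(UnitAddTorus (Fin n), ℂ)} {N : ℕ}
    (h : HasSymbol a σ N) (x₀ : UnitAddTorus (Fin n)) : ‖σ x₀‖ ≤ ‖a‖ := by
  refine le_of_forall_pos_le_add fun η hη => ?_
  obtain ⟨y, hy, hy'⟩ := exists_approx_eigenvector (ι := Unit) (fun _ => h) x₀ hη
  have hy0 : 0 < ‖y‖ := norm_pos_iff.2 hy
  refine le_of_mul_le_mul_right ?_ hy0
  calc ‖σ x₀‖ * ‖y‖ = ‖a y - (a y - σ x₀ • y)‖ := by rw [sub_sub_cancel, norm_smul]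
    _ ≤ ‖a y‖ + ‖a y - σ x₀ • y‖ := norm_sub_le _ _
    _ ≤ ‖a‖ * ‖y‖ + η * ‖y‖ := add_le_add (a.le_opNorm y) (hy' ())
    _ = (‖a‖ + η) * ‖y‖ := by ring

/-- Symbols of a family which is jointly bounded below have no common zero. -/
lemma exists_symbol_ne_zero {a : ι → Hn n →L[ℂ] Hn n} {σ : ι → C(UnitAddTorus (Fin n), ℂ)}
    {N : ℕ} (h : ∀ j, HasSymbol (a j) (σ j) N) {C : ℝ} (hC : ∀ x, ‖x‖ ≤ C * ∑ j, ‖a j x‖)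
    (x₀ : UnitAddTorus (Fin n)) : ∃ j, σ j x₀ ≠ 0 := by
  by_contra! h0
  set η : ℝ := (2 * (|C| * Fintype.card ι + 1))⁻¹ with hη
  have hη0 : 0 < η := by positivity
  obtain ⟨y, hy, hy'⟩ := exists_approx_eigenvector h x₀ hη0
  have hy0 : 0 < ‖y‖ := norm_pos_iff.2 hy
  have h1 : ∑ j, ‖a j y‖ ≤ Fintype.card ι * (η * ‖y‖) := by
    refine (Finset.sum_le_sum fun j _ => (?_ : _ ≤ η * ‖y‖)).trans (by simp)
    simpa [h0 j] using hy' j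
  have h2 : ‖y‖ ≤ |C| * Fintype.card ι * η * ‖y‖ :=
    calc ‖y‖ ≤ C * ∑ j, ‖a j y‖ := hC y
      _ ≤ |C| * ∑ j, ‖a j y‖ :=
        mul_le_mul_of_nonneg_right (le_abs_self C) (Finset.sum_nonneg fun _ _ => norm_nonneg _)
      _ ≤ |C| * (Fintype.card ι * (η * ‖y‖)) := mul_le_mul_of_nonneg_left h1 (abs_nonneg C)
      _ = _ := by ring
  have h3 : |C| * Fintype.card ι * η ≤ 1 / 2 := by
    rw [hη, ← div_eq_mul_inv, div_le_iff₀ (by positivity)]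
    linarith
  nlinarith

end LeftInverse

section LowerBound

lemma exists_zero_of_near_sin {ι : Type*} [Fintype ι] {F : (ι → ℝ) → (ι → ℝ)}
    (hF : ContDiff ℝ 1 F) (h : ∀ x i, |F x i - Real.sin (2 * Real.pi * x i)| ≤ 1 / 4) :
    ∃ x, F x = 0 := by
  classical
  let χ : ContDiffBump (0 : ι → ℝ) := ⟨1 / 8, 1 / 4, by norm_num, by norm_num⟩
  obtain ⟨x, hx⟩ := exists_zero_of_eq_id_outside_ball (f := fun x => x + χ x • (F x - x))
    (R := 1 / 4) (contDiff_id.add (χ.contDiff.smul (hF.sub contDiff_id))) (by norm_num)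
    (fun x hx => by
      have : χ x = 0 := χ.zero_of_le_dist ((dist_zero_right x).symm ▸ hx)
      simp [this])
  refine ⟨x, ?_⟩
  rcases le_or_gt ‖x‖ (1 / 8) with hle | hgt
  · have : χ x = 1 := χ.one_of_mem_closedBall (mem_closedBall_zero_iff.2 hle)
    simpa [this] using hx
  exfalso
  rcases le_or_gt (1 / 4) ‖x‖ with hge | hlt
  · have : χ x = 0 := χ.zero_of_le_dist ((dist_zero_right x).symm ▸ hge)
    have hx0 : x = 0 := by simpa [this] using hx
    rw [hx0, norm_zero] at hgt
    norm_num at hgt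
  obtain ⟨i, hi⟩ : ∃ i, 1 / 8 < |x i| := by
    by_contra! hcon
    exact hgt.not_ge ((pi_norm_le_iff_of_nonneg (by norm_num)).2 hcon)
  have hi' : |x i| < 1 / 4 := (norm_le_pi_norm x i).trans_lt hlt
  have h0 : (1 - χ x) * x i + χ x * F x i = 0 := by
    have := congr_fun hx i
    simp only [Pi.add_apply, Pi.smul_apply, Pi.sub_apply, smul_eq_mul, Pi.zero_apply] at this
    linarith
  have hχ0 : 0 ≤ χ x := χ.nonneg
  have hχ1 : χ x ≤ 1 := χ.le_one
  have hsin : ∀ t : ℝ, 1 / 8 < t → t < 1 / 4 → 1 / 2 ≤ Real.sin (2 * Real.pi * t) := fun t h1 h2 => by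
    have := Real.mul_le_sin (x := 2 * Real.pi * t) (by positivity)
      (by nlinarith [Real.pi_pos])
    have h4 : 2 / Real.pi * (2 * Real.pi * t) = 4 * t := by
      field_simp
      ring
    linarith
  have hFi := abs_le.1 (h x i)
  rcases le_or_gt 0 (x i) with hpos | hneg
  · rw [abs_of_nonneg hpos] at hi hi'
    have := hsin _ hi hi'
    nlinarith
  · rw [abs_of_neg hneg] at hi hi'
    have := hsin _ hi hi'
    rw [mul_neg, Real.sin_neg] at this
    nlinarith

variable {n : ℕ}

/-- An operator with symbol `sin (2πx_p) + i sin (2πx_q)`. -/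
def sinOp (p q : Fin n) : Hn n →L[ℂ] Hn n :=
  (-Complex.I / 2) • (shiftBy (Pi.single p 1) + (-1 : ℂ) • star (shiftBy (Pi.single p 1))) +
    (1 / 2 : ℂ) • (shiftBy (Pi.single q 1) + (-1 : ℂ) • star (shiftBy (Pi.single q 1)))

lemma sinOp_mem (p q : Fin n) : sinOp p q ∈ Toeplitz n := by
  have h : ∀ i : Fin n, shiftBy (Pi.single i 1) + (-1 : ℂ) • star (shiftBy (Pi.single i 1)) ∈
      Toeplitz n := fun i =>
    add_mem (polyToeplitz_le (shiftBy_mem _))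
      ((Toeplitz n).smul_mem (star_mem (polyToeplitz_le (shiftBy_mem _))) _)
  exact add_mem ((Toeplitz n).smul_mem (h p) _) ((Toeplitz n).smul_mem (h q) _)

lemma im_mFourier_single (p : Fin n) (t : Fin n → ℝ) :
    (mFourier (Pi.single p 1) fun i => (t i : UnitAddCircle)).im = Real.sin (2 * Real.pi * t p) := by
  rw [mFourier_single, fourier_coe_apply]
  have : 2 * (Real.pi : ℂ) * Complex.I * ((1 : ℤ) : ℂ) * (t p : ℂ) / ((1 : ℝ) : ℂ) =
    ((2 * Real.pi * t p : ℝ) : ℂ) * Complex.I := by push_cast; ring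
  rw [this, Complex.exp_ofReal_mul_I_im]

lemma exists_hasSymbol_sinOp (p q : Fin n) : ∃ τ, HasSymbol (sinOp p q) τ 1 ∧
    ∀ t : Fin n → ℝ, τ (fun i => (t i : UnitAddCircle)) =
      ⟨Real.sin (2 * Real.pi * t p), Real.sin (2 * Real.pi * t q)⟩ := by
  have h : ∀ i : Fin n, HasSymbol
      (shiftBy (Pi.single i 1) + (-1 : ℂ) • star (shiftBy (Pi.single i 1)))
      (mFourier (Pi.single i 1) + (-1 : ℂ) • mFourier (-Pi.single i 1)) 1 := fun i =>
    (HasSymbol.of_isShift (shiftBy_single_isShift i)).add_same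
      ((HasSymbol.star_of_isShift (shiftBy_single_isShift i)).smul _)
  refine ⟨_, ((h p).smul _).add_same ((h q).smul _), fun t => ?_⟩
  have hval : ∀ i : Fin n, (mFourier (Pi.single i 1) + (-1 : ℂ) • mFourier (-Pi.single i 1))
      (fun i => (t i : UnitAddCircle)) =
      ((2 * Real.sin (2 * Real.pi * t i) : ℝ) : ℂ) * Complex.I := fun i => by
    rw [ContinuousMap.add_apply, ContinuousMap.smul_apply, mFourier_neg, neg_one_smul,
      ← sub_eq_add_neg, Complex.sub_conj, im_mFourier_single]
  rw [ContinuousMap.add_apply, ContinuousMap.smul_apply, ContinuousMap.smul_apply, hval, hval]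
  generalize Real.sin (2 * Real.pi * t p) = u
  generalize Real.sin (2 * Real.pi * t q) = v
  apply Complex.ext
  · simp
    ring
  · simp

lemma not_dense_of_two_mul_le {m : ℕ} (hmn : m * 2 ≤ n) :
    ¬ Dense {a : Fin m → ↥(Toeplitz n) | ∃ b : Fin m → ↥(Toeplitz n), ∑ i, b i * a i = 1} := by
  intro hd
  let e : Fin m × Fin 2 → Fin n := fun k => Fin.castLE hmn (finProdFinEquiv k)
  have he : Function.Injective e :=
    (Fin.castLE_injective hmn).comp finProdFinEquiv.injective
  let a₀ : Fin m → Toeplitz n := fun j => ⟨sinOp (e (j, 0)) (e (j, 1)), sinOp_mem _ _⟩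
  obtain ⟨a, ⟨b, hb⟩, hdist⟩ := Metric.mem_closure_iff.1 (hd a₀) (1 / 8) (by norm_num)
  have hdist' : ∀ j, ‖(a j : Hn n →L[ℂ] Hn n) - a₀ j‖ < 1 / 8 := fun j => by
    rw [← dist_eq_norm, dist_comm]
    exact (dist_le_pi_dist a₀ a j).trans_lt hdist
  set B : ℝ := ∑ j, ‖(b j : Hn n →L[ℂ] Hn n)‖ with hB
  have hB0 : 0 ≤ B := Finset.sum_nonneg fun _ _ => norm_nonneg _
  set δ : ℝ := min (1 / 8) (1 / (2 * (B + 1))) with hδ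
  have hδ0 : 0 < δ := by positivity
  choose a' ha' hnear using fun j => exists_polyToeplitz_near (a j) hδ0
  choose σ N₀ hσ₀ using fun j => exists_hasSymbol (ha' j)
  obtain ⟨N, hσ⟩ : ∃ N, ∀ j, HasSymbol (a' j) (σ j) N :=
    ⟨Finset.univ.sup N₀, fun j => (hσ₀ j).mono (Finset.le_sup (Finset.mem_univ j))⟩
  have hbound : ∀ x, ‖x‖ ≤ 2 * B * ∑ j, ‖a' j x‖ := fun x => by
    have hx : x = ∑ j, (b j : Hn n →L[ℂ] Hn n) ((a j : Hn n →L[ℂ] Hn n) x) := by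
      have h1 : ∑ j, (b j : Hn n →L[ℂ] Hn n) * (a j : Hn n →L[ℂ] Hn n) = 1 := by
        have := congr_arg (Subtype.val : Toeplitz n → _) hb
        simpa using this
      have h2 := congr_arg (fun T : Hn n →L[ℂ] Hn n => T x) h1
      simpa [_root_.sum_apply] using h2.symm
    have hj : ∀ j, ‖(b j : Hn n →L[ℂ] Hn n) ((a j : Hn n →L[ℂ] Hn n) x)‖ ≤
        ‖(b j : Hn n →L[ℂ] Hn n)‖ * (∑ i, ‖a' i x‖ + δ * ‖x‖) := fun j => by
      refine (ContinuousLinearMap.le_opNorm _ _).trans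
        (mul_le_mul_of_nonneg_left ?_ (norm_nonneg _))
      calc ‖(a j : Hn n →L[ℂ] Hn n) x‖ = ‖a' j x + ((a j : Hn n →L[ℂ] Hn n) - a' j) x‖ := by
            rw [_root_.sub_apply, add_sub_cancel]
        _ ≤ ‖a' j x‖ + ‖((a j : Hn n →L[ℂ] Hn n) - a' j) x‖ := norm_add_le _ _
        _ ≤ ∑ i, ‖a' i x‖ + δ * ‖x‖ := add_le_add
            (Finset.single_le_sum (f := fun i => ‖a' i x‖) (fun _ _ => norm_nonneg _)
              (Finset.mem_univ j))
            (ContinuousLinearMap.le_of_opNorm_le _ (hnear j).le x)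
    have h1 : ‖x‖ ≤ B * (∑ i, ‖a' i x‖ + δ * ‖x‖) := by
      conv_lhs => rw [hx]
      refine (norm_sum_le _ _).trans ((Finset.sum_le_sum fun j _ => hj j).trans_eq ?_)
      rw [hB, Finset.sum_mul]
    have h2 : B * δ ≤ 1 / 2 := by
      refine (mul_le_mul_of_nonneg_left (min_le_right _ _) hB0).trans ?_
      rw [mul_one_div, div_le_iff₀ (by positivity)]
      linarith
    nlinarith [norm_nonneg x]
  let pt : (Fin m × Fin 2 → ℝ) → Fin n → ℝ := fun x => Function.extend e x 0
  have hpt : ∀ x k, pt x (e k) = x k := fun x k => he.extend_apply _ _ _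
  have hptC : ContDiff ℝ 1 pt := by
    refine contDiff_pi.2 fun i => ?_
    by_cases hi : ∃ k, e k = i
    · obtain ⟨k, rfl⟩ := hi
      simp_rw [hpt]
      fun_prop
    · have : (fun x => pt x i) = fun _ => 0 :=
        funext fun x => Function.extend_apply' _ _ _ hi
      rw [this]
      exact contDiff_const
  let s : Fin m → (Fin m × Fin 2 → ℝ) → ℂ := fun j x => σ j fun i => (pt x i : UnitAddCircle)
  have hsC : ∀ j, ContDiff ℝ 1 (s j) := fun j =>
    (contDiff_comp_coe_of_mem_trigPoly (hσ j).mem_trigPoly).comp hptC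
  have hs : ∀ j x, ‖s j x - ⟨Real.sin (2 * Real.pi * x (j, 0)),
      Real.sin (2 * Real.pi * x (j, 1))⟩‖ ≤ 1 / 4 := fun j x => by
    obtain ⟨τ, hτ, hτ'⟩ := exists_hasSymbol_sinOp (e (j, 0)) (e (j, 1))
    have h1 := ((hσ j).add (hτ.smul (-1))).norm_apply_le fun i => (pt x i : UnitAddCircle)
    rw [ContinuousMap.add_apply, ContinuousMap.smul_apply, neg_one_smul, neg_one_smul,
      ← sub_eq_add_neg, ← sub_eq_add_neg, hτ', hpt, hpt] at h1
    refine h1.trans ?_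
    have h2 : a' j - sinOp (e (j, 0)) (e (j, 1)) =
      ((a j : Hn n →L[ℂ] Hn n) - a₀ j) - ((a j : Hn n →L[ℂ] Hn n) - a' j) := by
      rw [sub_sub_sub_cancel_left]
    rw [h2]
    have h3 := (hnear j).trans_le (min_le_left _ _)
    linarith [norm_sub_le ((a j : Hn n →L[ℂ] Hn n) - a₀ j) ((a j : Hn n →L[ℂ] Hn n) - a' j),
      hdist' j]
  let F : (Fin m × Fin 2 → ℝ) → (Fin m × Fin 2 → ℝ) :=
    fun x k => if k.2 = 0 then (s k.1 x).re else (s k.1 x).im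
  obtain ⟨x, hx⟩ := exists_zero_of_near_sin (F := F)
    (contDiff_pi.2 fun k => by
      rcases k with ⟨j, l⟩
      by_cases hl : l = 0
      · simpa [F, hl, Function.comp_def] using Complex.reCLM.contDiff.comp (hsC j)
      · simpa [F, hl, Function.comp_def] using Complex.imCLM.contDiff.comp (hsC j))
    (fun x k => by
      rcases k with ⟨j, l⟩
      by_cases hl : l = 0
      · subst hl
        simpa [F] using (Complex.abs_re_le_norm _).trans (hs j x)
      · obtain rfl : l = 1 := by omega
        simpa [F] using (Complex.abs_im_le_norm _).trans (hs j x))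
  obtain ⟨j, hj⟩ := exists_symbol_ne_zero hσ hbound fun i => (pt x i : UnitAddCircle)
  refine hj (Complex.ext ?_ ?_)
  · simpa [F] using congr_fun hx (j, 0)
  · simpa [F] using congr_fun hx (j, 1)

end LowerBound

section UpperBound

variable {n : ℕ}

lemma exists_const_no_common_zero {m : ℕ} (hnm : n < 2 * m)
    {σ : Fin m → C(UnitAddTorus (Fin n), ℂ)} {Z : Set (Fin n → ℤ)} (hσ : ∀ j, σ j ∈ trigPoly Z)
    {ε : ℝ} (hε : 0 < ε) :
    ∃ c : Fin m → ℂ, (∀ j, ‖c j‖ < ε) ∧ ∃ δ > 0, ∀ x, δ ≤ ∑ j, ‖(σ j + c j • 1) x‖ ^ 2 := by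
  let f : (Fin n → ℝ) → (Fin m → ℂ) := fun x j => σ j fun i => (x i : UnitAddCircle)
  have hf : ContDiff ℝ 1 f := contDiff_pi.2 fun j => contDiff_comp_coe_of_mem_trigPoly (hσ j)
  have hd : Dense (Set.range f)ᶜ := hf.dense_compl_range_of_finrank_lt_finrank (by
    simpa [Module.finrank_pi_fintype, Complex.finrank_real_complex, mul_comm m 2] using hnm)
  obtain ⟨y, hy, hyε⟩ := Metric.mem_closure_iff.1 (hd 0) ε hε
  rw [dist_zero_left] at hyε
  refine ⟨fun j => -y j, fun j => ?_, ?_⟩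
  · rw [norm_neg]
    exact (norm_le_pi_norm y j).trans_lt hyε
  obtain ⟨x₁, -, hx₁⟩ := isCompact_univ.exists_isMinOn Set.univ_nonempty
    (f := fun x : UnitAddTorus (Fin n) => ∑ j, ‖(σ j + (-y j) • 1) x‖ ^ 2)
    (Continuous.continuousOn (by fun_prop))
  refine ⟨_, ?_, fun x => hx₁ (Set.mem_univ x)⟩
  have hnn : ∀ j ∈ Finset.univ, 0 ≤ ‖(σ j + (-y j) • 1) x₁‖ ^ 2 := fun j _ => by positivity
  refine lt_of_le_of_ne (Finset.sum_nonneg hnn) fun h0 => hy ?_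
  choose t ht using fun i => QuotientAddGroup.mk_surjective (x₁ i)
  have ht' : (fun i => (t i : UnitAddCircle)) = x₁ := funext ht
  refine ⟨t, funext fun j => ?_⟩
  have := (Finset.sum_eq_zero_iff_of_nonneg hnn).1 h0.symm j (Finset.mem_univ j)
  simp only [ne_eq, OfNat.ofNat_ne_zero, not_false_eq_true, pow_eq_zero_iff, norm_eq_zero,
    ContinuousMap.add_apply, ContinuousMap.smul_apply, ContinuousMap.one_apply, smul_eq_mul,
    mul_one, add_neg_eq_zero] at this
  show σ j (fun i => (t i : UnitAddCircle)) = y j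
  rw [ht', this]

lemma sqrt_mul_norm_toL2_le {d ι : Type*} [Fintype d] [Fintype ι]
    {σ : ι → C(UnitAddTorus d, ℂ)} {δ : ℝ} (hδ : 0 ≤ δ)
    (h : ∀ x, δ ≤ ∑ j, ‖σ j x‖ ^ 2) (F : C(UnitAddTorus d, ℂ)) :
    √δ * ‖toL2 F‖ ≤ ∑ j, ‖toL2 (σ j * F)‖ := by
  refine (sq_le_sq₀ (by positivity) (Finset.sum_nonneg fun _ _ => norm_nonneg _)).1 ?_
  rw [mul_pow, Real.sq_sqrt hδ]
  exact (le_sum_norm_toL2_mul_sq h F).trans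
    (Finset.sum_sq_le_sq_sum_of_nonneg fun _ _ => norm_nonneg _)

/-- The commutator trick: in `σ₁ y₂ - σ₂ y₁` the contribution of `G` cancels, and the contribution
of `R` to `y₂` lives at frequencies different from those of the remaining terms. -/
lemma norm_toL2_mul_le_of_windows {σ₁ σ₂ r₁ r₂ G R : C(UnitAddTorus (Fin n), ℂ)} {N M₁ M₂ : ℕ}
    (hσ₁ : σ₁ ∈ trigPoly (boxSet n N)) (hσ₂ : σ₂ ∈ trigPoly (boxSet n N))
    (hr₁ : r₁ ∈ trigPoly ((fun (z : Fin n → ℕ) i => (z i : ℤ)) '' lowSet n (N + N)))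
    (hr₂ : r₂ ∈ trigPoly ((fun (z : Fin n → ℕ) i => (z i : ℤ)) '' lowSet n (N + N)))
    (hR : R ∈ trigPoly ((fun (z : Fin n → ℕ) i => (z i : ℤ)) '' lowSet n N))
    (h₂ : 4 * N ≤ M₂) (h₁₂ : M₁ + 4 * N ≤ M₂ ∨ M₂ + 4 * N ≤ M₁) (c : ℂ) :
    ‖c‖ * ‖toL2 (σ₁ * R)‖ ≤
      ‖σ₂‖ * ‖toL2 (r₁ + σ₁ * G + c • ((mFourier fun _ => (M₁ : ℤ)) * R))‖ +
        ‖σ₁‖ * ‖toL2 (r₂ + σ₂ * G + c • ((mFourier fun _ => (M₂ : ℤ)) * R))‖ := by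
  let W : ℕ → Set (Fin n → ℤ) :=
    fun M => {k | (∀ i, (M : ℤ) - N ≤ k i) ∧ ∃ i, k i < M + 2 * N}
  let L : Set (Fin n → ℤ) := {k | ∃ i, k i < 3 * N}
  have hW : ∀ (M : ℕ) {σ : C(UnitAddTorus (Fin n), ℂ)}, σ ∈ trigPoly (boxSet n N) →
      (mFourier fun _ => (M : ℤ)) * (σ * R) ∈ trigPoly (W M) := fun M σ hσ => by
    refine trigPoly_mono ?_
      (mul_mem_trigPoly (mFourier_mem_trigPoly rfl) (mul_mem_trigPoly hσ hR))
    rintro _ ⟨_, rfl, _, ⟨k, hk, _, ⟨z, ⟨i, hi⟩, rfl⟩, rfl⟩, rfl⟩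
    refine ⟨fun l => ?_, i, ?_⟩
    · have := (abs_le.1 (hk l)).1
      simp only [Pi.add_apply]
      omega
    · have := (abs_le.1 (hk i)).2
      simp only [Pi.add_apply]
      omega
  have hL : ∀ {σ r : C(UnitAddTorus (Fin n), ℂ)}, σ ∈ trigPoly (boxSet n N) →
      r ∈ trigPoly ((fun (z : Fin n → ℕ) i => (z i : ℤ)) '' lowSet n (N + N)) →
      σ * r ∈ trigPoly L := fun {σ r} hσ hr => by
    refine trigPoly_mono ?_ (mul_mem_trigPoly hσ hr)
    rintro _ ⟨k, hk, _, ⟨z, ⟨i, hi⟩, rfl⟩, rfl⟩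
    refine ⟨i, ?_⟩
    have := (abs_le.1 (hk i)).2
    simp only [Pi.add_apply]
    omega
  have hdisj : Disjoint (W M₂) (L ∪ W M₁) := by
    refine Set.disjoint_left.2 ?_
    rintro k ⟨hk, l, hl⟩ (⟨i, hi⟩ | ⟨hk', i, hi⟩)
    · have := hk i
      omega
    · have := hk i
      have := hk' l
      omega
  set e₁ : C(UnitAddTorus (Fin n), ℂ) := mFourier fun _ => (M₁ : ℤ) with he₁
  set e₂ : C(UnitAddTorus (Fin n), ℂ) := mFourier fun _ => (M₂ : ℤ) with he₂
  have hrest : σ₁ * r₂ - σ₂ * r₁ - c • (e₁ * (σ₂ * R)) ∈ trigPoly (L ∪ W M₁) :=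
    sub_mem (trigPoly_mono Set.subset_union_left (sub_mem (hL hσ₁ hr₂) (hL hσ₂ hr₁)))
      (trigPoly_mono Set.subset_union_right (Submodule.smul_mem _ c (hW M₁ hσ₂)))
  have hid : c • (e₂ * (σ₁ * R)) + (σ₁ * r₂ - σ₂ * r₁ - c • (e₁ * (σ₂ * R))) =
      σ₁ * (r₂ + σ₂ * G + c • (e₂ * R)) - σ₂ * (r₁ + σ₁ * G + c • (e₁ * R)) := by
    simp only [mul_add, mul_smul_comm, mul_left_comm σ₁ e₂ R, mul_left_comm σ₂ e₁ R,
      mul_left_comm σ₁ σ₂ G]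
    abel
  have h := norm_toL2_le_norm_toL2_add hdisj (Submodule.smul_mem _ c (hW M₂ hσ₁)) hrest
  rw [hid, map_smul, norm_smul, he₂, norm_toL2_mFourier_mul, map_sub] at h
  refine h.trans ((norm_sub_le _ _).trans ?_)
  rw [add_comm]
  exact add_le_add (norm_toL2_mul_le _ _) (norm_toL2_mul_le _ _)

/-- The projection onto the span of the `δ_z` with some coordinate of `z` smaller than `N`. -/
def lowProj (n N : ℕ) : Hn n →L[ℂ] Hn n :=
  1 - shiftBy (fun _ => N) * star (shiftBy fun _ => N)

lemma lowProj_mem (n N : ℕ) : lowProj n N ∈ polyToeplitz n :=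
  sub_mem (one_mem _) (mul_mem (shiftBy_mem _) (star_mem (shiftBy_mem _)))

lemma lowProj_delta_of_mem {N : ℕ} {z : Fin n → ℕ} (hz : z ∈ lowSet n N) :
    lowProj n N (delta z) = delta z := by
  obtain ⟨i, hi⟩ := hz
  have : ¬ (fun _ => N) ≤ z := fun h => (h i).not_gt hi
  rw [lowProj, _root_.sub_apply, mul_apply_eq_comp, star_apply_delta (shiftBy_delta _),
    if_neg this, map_zero, sub_zero, one_apply_eq_self]

lemma lowProj_delta_of_notMem {N : ℕ} {z : Fin n → ℕ} (hz : z ∉ lowSet n N) :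
    lowProj n N (delta z) = 0 := by
  have : (fun _ => N) ≤ z := fun i => not_lt.1 fun hi => hz ⟨i, hi⟩
  rw [lowProj, _root_.sub_apply, mul_apply_eq_comp, star_apply_delta (shiftBy_delta _),
    if_pos this, shiftBy_delta, tsub_add_cancel_of_le this, one_apply_eq_self, sub_self]

lemma lowProj_apply_mem {N : ℕ} {x : Hn n} (hx : x ∈ finSupp Set.univ) :
    lowProj n N x ∈ finSupp (lowSet n N) := by
  refine map_mem_finSupp (fun z _ => ?_) hx
  by_cases hz : z ∈ lowSet n N
  · rw [lowProj_delta_of_mem hz]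
    exact delta_mem_finSupp hz
  · rw [lowProj_delta_of_notMem hz]
    exact zero_mem _

lemma sub_lowProj_apply_mem {N : ℕ} {x : Hn n} (hx : x ∈ finSupp Set.univ) :
    x - lowProj n N x ∈ finSupp (highSet n N) := by
  refine map_mem_finSupp (a := 1 - lowProj n N) (fun z _ => ?_) hx
  rw [_root_.sub_apply, one_apply_eq_self]
  by_cases hz : z ∈ lowSet n N
  · rw [lowProj_delta_of_mem hz, sub_self]
    exact zero_mem _
  · rw [lowProj_delta_of_notMem hz, sub_zero]
    exact delta_mem_finSupp fun i => not_lt.1 fun hi => hz ⟨i, hi⟩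

/-- The operator moving the layer of width `N` along the boundary of `ℕ^n` by `(M, …, M)`. -/
def layerShift (n N M : ℕ) : Hn n →L[ℂ] Hn n := shiftBy (fun _ => M) * lowProj n N

/-- Moving the boundary layer by sufficiently different amounts makes a family of operators whose
symbols have no common zero jointly bounded below. -/
lemma exists_bound_add_layerShift {m : ℕ} (hm : 2 ≤ m) {a : Fin m → Hn n →L[ℂ] Hn n}
    {σ : Fin m → C(UnitAddTorus (Fin n), ℂ)} {N : ℕ} (h : ∀ j, HasSymbol (a j) (σ j) N)
    {δ : ℝ} (hδ : 0 < δ) (hσ : ∀ x, δ ≤ ∑ j, ‖σ j x‖ ^ 2) {c : ℂ} (hc : c ≠ 0) :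
    ∃ C : ℝ, ∀ x, ‖x‖ ≤ C * ∑ j : Fin m, ‖(a j + c • layerShift n N (4 * N * (j + 1))) x‖ := by
  set b : Fin m → Hn n →L[ℂ] Hn n := fun j => a j + c • layerShift n N (4 * N * (j + 1)) with hb
  set S : Fin m → Hn n →L[ℂ] Hn n := fun j => shiftBy fun _ => 4 * N * (j + 1) with hS
  set B : ℝ := ∑ j, ‖σ j‖
  have hB : ∀ j, ‖σ j‖ ≤ B := fun j =>
    Finset.single_le_sum (f := fun j => ‖σ j‖) (fun _ _ => norm_nonneg _) (Finset.mem_univ j)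
  set D : ℝ := ∑ j, (‖a j‖ + ‖c • S j‖)
  set C₁ : ℝ := m * (2 * B / ‖c‖) / √δ
  have hc0 : 0 < ‖c‖ := norm_pos_iff.2 hc
  have hδ0 : 0 < √δ := Real.sqrt_pos.2 hδ
  refine ⟨C₁ + (1 + D * C₁) / √δ, fun x => ?_⟩
  have hcl : IsClosed {x : Hn n | ‖x‖ ≤ (C₁ + (1 + D * C₁) / √δ) * ∑ j, ‖b j x‖} :=
    isClosed_le (by fun_prop) (by fun_prop)
  refine hcl.closure_subset_iff.2 (fun x hx => ?_) (dense_finSupp_univ x)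
  set Y := ∑ j, ‖b j x‖ with hY
  have hYj : ∀ j, ‖b j x‖ ≤ Y := fun j =>
    Finset.single_le_sum (f := fun j => ‖b j x‖) (fun _ _ => norm_nonneg _) (Finset.mem_univ j)
  set xl := lowProj n N x with hxl
  have hl : xl ∈ finSupp (lowSet n N) := lowProj_apply_mem hx
  have hh : x - xl ∈ finSupp (highSet n N) := sub_lowProj_apply_mem hx
  obtain ⟨R, hR, hRx⟩ := exists_toL2_eq_fourierH hl
  obtain ⟨G, -, hGx⟩ := exists_toL2_eq_fourierH hh
  choose r hr hrx using fun j => exists_toL2_eq_fourierH (map_mem_finSupp ((h j).low N) hl)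
  have hσG : ∀ j, fourierH (a j (x - xl)) = toL2 (σ j * G) := fun j => by
    obtain ⟨G', -, hG', hG''⟩ := exists_fourierH_eq (h j).fourier hh
    rwa [← toL2_injective (hGx.symm.trans hG')] at hG''
  have hbx : ∀ j, b j x = a j xl + a j (x - xl) + c • S j xl := fun j => by
    rw [← map_add, add_sub_cancel]
    rfl
  have hbF : ∀ j : Fin m, ‖b j x‖ = ‖toL2 (r j + σ j * G +
      c • ((mFourier fun _ => ((4 * N * (j + 1) : ℕ) : ℤ)) * R))‖ := fun j => by
    rw [← fourierH.norm_map, hbx, map_add, map_add, map_smul, hrx, hσG, fourierH_shiftBy hl hRx,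
      map_add, map_add, map_smul]
  have hlow : ‖xl‖ ≤ C₁ * Y := by
    rw [← fourierH.norm_map, hRx]
    have hj : ∀ j, ‖toL2 (σ j * R)‖ ≤ 2 * B / ‖c‖ * Y := fun j => by
      have : Nontrivial (Fin m) := Fin.nontrivial_iff_two_le.2 hm
      obtain ⟨j', hj'⟩ := exists_ne j
      have hsep : 4 * N * ((j : ℕ) + 1) + 4 * N ≤ 4 * N * ((j' : ℕ) + 1) ∨
          4 * N * ((j' : ℕ) + 1) + 4 * N ≤ 4 * N * ((j : ℕ) + 1) := by
        rcases lt_or_gt_of_ne (Fin.val_ne_of_ne hj') with hlt | hlt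
        · right; nlinarith
        · left; nlinarith
      have key := norm_toL2_mul_le_of_windows (G := G) (h j).mem_trigPoly (h j').mem_trigPoly
        (hr j) (hr j') hR (Nat.le_mul_of_pos_right _ j'.val.succ_pos) hsep c
      rw [← hbF, ← hbF] at key
      rw [div_mul_eq_mul_div, le_div_iff₀ hc0]
      nlinarith [mul_le_mul (hB j) (hYj j') (norm_nonneg _) ((norm_nonneg _).trans (hB j)),
        mul_le_mul (hB j') (hYj j) (norm_nonneg _) ((norm_nonneg _).trans (hB j))]
    have h1 := (sqrt_mul_norm_toL2_le hδ.le hσ R).trans (Finset.sum_le_sum fun j _ => hj j)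
    rw [Finset.sum_const, Finset.card_univ, Fintype.card_fin, nsmul_eq_mul] at h1
    rw [div_mul_eq_mul_div, le_div_iff₀ hδ0]
    linarith
  have hhigh : ‖x - xl‖ ≤ (1 + D * C₁) / √δ * Y := by
    have hj : ∀ j, ‖toL2 (σ j * G)‖ ≤ ‖b j x‖ + (‖a j‖ + ‖c • S j‖) * (C₁ * Y) := fun j => by
      rw [← hσG, fourierH.norm_map]
      have h1 : a j (x - xl) = b j x - (a j xl + (c • S j) xl) := by
        rw [hbx, _root_.smul_apply]
        abel
      have h2 : ‖a j xl + (c • S j) xl‖ ≤ (‖a j‖ + ‖c • S j‖) * ‖xl‖ := by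
        rw [add_mul]
        exact (norm_add_le _ _).trans
          (add_le_add (ContinuousLinearMap.le_opNorm _ _) (ContinuousLinearMap.le_opNorm _ _))
      rw [h1]
      refine (norm_sub_le _ _).trans (add_le_add le_rfl (h2.trans ?_))
      exact mul_le_mul_of_nonneg_left hlow (by positivity)
    have h1 := (sqrt_mul_norm_toL2_le hδ.le hσ G).trans (Finset.sum_le_sum fun j _ => hj j)
    rw [Finset.sum_add_distrib, ← Finset.sum_mul, ← hGx, fourierH.norm_map] at h1
    rw [div_mul_eq_mul_div, le_div_iff₀ hδ0]
    linarith
  calc ‖x‖ = ‖xl + (x - xl)‖ := by rw [add_sub_cancel]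
    _ ≤ ‖xl‖ + ‖x - xl‖ := norm_add_le _ _
    _ ≤ C₁ * Y + (1 + D * C₁) / √δ * Y := add_le_add hlow hhigh
    _ = _ := by ring

lemma dense_of_lt_two_mul {m : ℕ} (hm : 2 ≤ m) (hnm : n < 2 * m) :
    Dense {a : Fin m → ↥(Toeplitz n) | ∃ b : Fin m → ↥(Toeplitz n), ∑ i, b i * a i = 1} := by
  intro a
  refine Metric.mem_closure_iff.2 fun ε hε => ?_
  have hε3 : 0 < ε / 3 := by positivity
  choose a' ha' hnear using fun j => exists_polyToeplitz_near (a j) hε3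
  choose σ N₀ hσ₀ using fun j => exists_hasSymbol (ha' j)
  obtain ⟨N, hσ⟩ : ∃ N, ∀ j, HasSymbol (a' j) (σ j) N :=
    ⟨Finset.univ.sup N₀, fun j => (hσ₀ j).mono (Finset.le_sup (Finset.mem_univ j))⟩
  obtain ⟨c, hc, δ, hδ, hδσ⟩ := exists_const_no_common_zero hnm
    (fun j => (hσ j).mem_trigPoly) hε3
  have hsym : ∀ j, HasSymbol (a' j + c j • 1) (σ j + c j • 1) N := fun j =>
    (hσ j).add_same ((HasSymbol.one.mono (Nat.zero_le N)).smul (c j))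
  set L : Fin m → Hn n →L[ℂ] Hn n := fun j => layerShift n N (4 * N * (j + 1))
  set K : ℝ := ∑ j, ‖L j‖
  have hK : ∀ j, ‖L j‖ ≤ K := fun j =>
    Finset.single_le_sum (f := fun j => ‖L j‖) (fun _ _ => norm_nonneg _) (Finset.mem_univ j)
  have hK0 : 0 ≤ K := Finset.sum_nonneg fun _ _ => norm_nonneg _
  set η : ℝ := ε / 3 / (K + 1) with hη
  have hη0 : 0 < η := by positivity
  obtain ⟨C, hC⟩ := exists_bound_add_layerShift hm hsym hδ hδσ
    (c := (η : ℂ)) (by exact_mod_cast hη0.ne')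
  have hmem : ∀ j, a' j + c j • 1 + (η : ℂ) • L j ∈ polyToeplitz n := fun j =>
    add_mem (add_mem (ha' j) ((polyToeplitz n).smul_mem (one_mem _) _))
      ((polyToeplitz n).smul_mem (mul_mem (shiftBy_mem _) (lowProj_mem n N)) _)
  let b : Fin m → Toeplitz n := fun j => ⟨_, polyToeplitz_le (hmem j)⟩
  refine ⟨b, exists_sum_mul_eq_one b hC, (dist_pi_lt_iff hε).2 fun j => ?_⟩
  have h1 : ‖c j • (1 : Hn n →L[ℂ] Hn n)‖ < ε / 3 := by
    rw [norm_smul]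
    exact (mul_le_of_le_one_right (norm_nonneg _) ContinuousLinearMap.norm_id_le).trans_lt (hc j)
  have h2 : ‖(η : ℂ) • L j‖ < ε / 3 := by
    rw [norm_smul, Complex.norm_real, Real.norm_of_nonneg hη0.le, hη, div_mul_eq_mul_div,
      div_lt_iff₀ (by positivity)]
    exact mul_lt_mul_of_pos_left ((hK j).trans_lt (lt_add_one K)) hε3
  have h3 : dist (a j) (b j) =
      ‖((a j : Hn n →L[ℂ] Hn n) - a' j) - c j • (1 : Hn n →L[ℂ] Hn n) - (η : ℂ) • L j‖ := by
    rw [sub_sub, sub_sub, ← add_assoc, ← dist_eq_norm]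
    rfl
  rw [h3]
  linarith [norm_sub_le ((a j : Hn n →L[ℂ] Hn n) - a' j - c j • (1 : Hn n →L[ℂ] Hn n))
    ((η : ℂ) • L j), norm_sub_le ((a j : Hn n →L[ℂ] Hn n) - a' j) (c j • (1 : Hn n →L[ℂ] Hn n)),
    hnear j]

end UpperBound

theorem stmt13 (n : ℕ) (hn : 1 < n) (m : ℕ) (hm : 1 ≤ m) :
    Dense {a : Fin m → ↥(Toeplitz n) |
        ∃ b : Fin m → ↥(Toeplitz n), ∑ i, b i * a i = 1} ↔
      n / 2 + 1 ≤ m := by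
  constructor
  · intro hd
    by_contra hlt
    exact not_dense_of_two_mul_le (by omega) hd
  · intro hle
    exact dense_of_lt_two_mul (by omega) (by omega)
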